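/- Let α = (α,…,α,α₁,…,α_r) where α appears k ≥ 1 times and α < α_i for all i, and let β = (α₁,…,α_r). Then σ_α(x) ∼ σ_k(x^{1/α}) · ∑_{n ∈ 𝒫_β^σ} n^{-1/α} as x → ∞. -/

import Mathlib

open Filter Asymptotics Real

/-- The set of integers expressible as `p₁^{β 0} ⋯ p_r^{β (r-1)}` for primes `pᵢ`
(repetitions allowed). -/
def Psigma {r : ℕ} (β : Fin r → ℕ) : Set ℕ :=
  {n | ∃ p : Fin r → ℕ, (∀ i, (p i).Prime) ∧ n = ∏ i, p i ^ β i}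

/-- The set of integers expressible as `p₁^{β 0} ⋯ p_r^{β (r-1)}` for pairwise distinct
primes `pᵢ`. -/
def Ppi {r : ℕ} (β : Fin r → ℕ) : Set ℕ :=
  {n | ∃ p : Fin r → ℕ, (∀ i, (p i).Prime) ∧ Function.Injective p ∧ n = ∏ i, p i ^ β i}

/-- The number of `n ∈ S` with `n ≤ x`. -/
noncomputable def countIn (S : Set ℕ) (x : ℝ) : ℕ :=
  Nat.card {n : ℕ | (n : ℝ) ≤ x ∧ n ∈ S}

section

open MeasureTheory
open scoped Topology ArithmeticFunction.Omega

/-- The tent function, supported on `[-1, 1]`. -/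
noncomputable def tent (x : ℝ) : ℝ := max (1 - |x|) 0

/-- The Fejér kernel (away from `0`), the Fourier transform of the tent function. -/
noncomputable def fejer (w : ℝ) : ℝ := 2 * (1 - cos w) / w ^ 2

lemma continuous_tent : Continuous tent := by unfold tent; fun_prop

lemma tent_nonneg (x : ℝ) : 0 ≤ tent x := le_max_right _ _

lemma tent_eq_zero {x : ℝ} (hx : 1 ≤ |x|) : tent x = 0 := by
  unfold tent; exact max_eq_right (by linarith)

lemma integrable_tent : Integrable tent :=
  continuous_tent.integrable_of_hasCompactSupport
    (HasCompactSupport.intro (isCompact_Icc (a := (-1 : ℝ)) (b := 1)) fun x hx => tent_eq_zero (by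
      by_contra! h
      exact hx (abs_le.1 h.le)))

lemma integral_tent_mul_cexp {w : ℝ} (hw : w ≠ 0) :
    ∫ x : ℝ, (tent x : ℂ) * Complex.exp (Complex.I * w * x) = fejer w := by
  have hc : (Complex.I * w : ℂ) ≠ 0 := by simp [hw]
  have hcont : Continuous fun x : ℝ => (tent x : ℂ) * Complex.exp (Complex.I * w * x) := by
    have := continuous_tent
    fun_prop
  set c : ℂ := Complex.I * w with hcdef
  have hexp (x : ℝ) :
      HasDerivAt (fun y : ℝ => Complex.exp (c * y)) (c * Complex.exp (c * x)) x := by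
    have h1 : HasDerivAt (fun y : ℝ => c * (y : ℂ)) c x := by
      simpa using (Complex.ofRealCLM.hasDerivAt (x := x)).const_mul c
    simpa [mul_comm] using h1.cexp
  have hid (x : ℝ) : HasDerivAt (fun y : ℝ => (y : ℂ)) 1 x := by
    simpa using (hasDerivAt_id x).ofReal_comp
  have hright : ∫ x in (0 : ℝ)..1, (tent x : ℂ) * Complex.exp (c * x) =
      Complex.exp c / c ^ 2 - 1 / c - 1 / c ^ 2 := by
    have := intervalIntegral.integral_eq_sub_of_hasDerivAt (a := 0) (b := 1)
      (f := fun x : ℝ => (1 - (x : ℂ)) * Complex.exp (c * x) / c + Complex.exp (c * x) / c ^ 2)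
      (f' := fun x : ℝ => (1 - (x : ℂ)) * Complex.exp (c * x))
      (fun x _ => by
        have := ((((hid x).const_sub 1).mul (hexp x)).div_const c).add ((hexp x).div_const (c ^ 2))
        refine this.congr_deriv ?_
        field_simp
        ring)
      (Continuous.intervalIntegrable (by fun_prop) _ _)
    rw [intervalIntegral.integral_congr (g := fun x : ℝ => (1 - (x : ℂ)) * Complex.exp (c * x)),
      this]
    · simp; ring
    · intro x hx
      rw [Set.uIcc_of_le zero_le_one] at hx
      have : tent x = 1 - x := by
        rw [tent, abs_of_nonneg hx.1, max_eq_left (by linarith [hx.2])]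
      simp [this]
  have hleft : ∫ x in (-1 : ℝ)..0, (tent x : ℂ) * Complex.exp (c * x) =
      1 / c - 1 / c ^ 2 + Complex.exp (-c) / c ^ 2 := by
    have := intervalIntegral.integral_eq_sub_of_hasDerivAt (a := -1) (b := 0)
      (f := fun x : ℝ => (1 + (x : ℂ)) * Complex.exp (c * x) / c - Complex.exp (c * x) / c ^ 2)
      (f' := fun x : ℝ => (1 + (x : ℂ)) * Complex.exp (c * x))
      (fun x _ => by
        have := ((((hid x).const_add 1).mul (hexp x)).div_const c).sub ((hexp x).div_const (c ^ 2))
        refine this.congr_deriv ?_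
        field_simp
        ring)
      (Continuous.intervalIntegrable (by fun_prop) _ _)
    rw [intervalIntegral.integral_congr (g := fun x : ℝ => (1 + (x : ℂ)) * Complex.exp (c * x)),
      this]
    · simp
    · intro x hx
      rw [Set.uIcc_of_le (by norm_num)] at hx
      have : tent x = 1 + x := by
        rw [tent, abs_of_nonpos hx.2, max_eq_left (by linarith [hx.1])]; ring
      simp [this]
  have hsupp : ∫ x : ℝ, (tent x : ℂ) * Complex.exp (c * x) =
      ∫ x in (-1 : ℝ)..1, (tent x : ℂ) * Complex.exp (c * x) := by
    rw [intervalIntegral.integral_eq_integral_of_support_subset]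
    intro x hx
    by_contra h
    refine hx ?_
    have : 1 ≤ |x| := by
      by_contra! h'
      exact h ⟨(abs_lt.1 h').1, (abs_lt.1 h').2.le⟩
    simp [tent_eq_zero this]
  rw [hsupp, ← intervalIntegral.integral_add_adjacent_intervals (b := 0)
    (hcont.intervalIntegrable _ _) (hcont.intervalIntegrable _ _), hleft, hright]
  have hcos : (Complex.cos w) = (Complex.exp c + Complex.exp (-c)) / 2 := by
    rw [Complex.cos, hcdef]; ring_nf
  have hw' : (w : ℂ) ≠ 0 := by exact_mod_cast hw
  have hc2 : c ^ 2 = - (w : ℂ) ^ 2 := by rw [hcdef, mul_pow, Complex.I_sq]; ring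
  rw [fejer]
  push_cast
  rw [hcos, hc2]
  field_simp
  ring

lemma fejer_nonneg (w : ℝ) : 0 ≤ fejer w :=
  div_nonneg (by nlinarith [cos_le_one w]) (sq_nonneg w)

lemma measurable_fejer : Measurable fejer := by unfold fejer; fun_prop

lemma fejer_le (w : ℝ) : fejer w ≤ 5 * (1 + w ^ 2)⁻¹ := by
  rcases eq_or_ne w 0 with rfl | hw
  · simp [fejer]
  have hw2 : 0 < w ^ 2 := by positivity
  rw [fejer, ← div_eq_mul_inv, div_le_div_iff₀ hw2 (by positivity)]
  nlinarith [neg_one_le_cos w, one_sub_sq_div_two_le_cos (x := w)]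

lemma integrable_fejer : Integrable fejer :=
  (integrable_inv_one_add_sq.const_mul 5).mono' measurable_fejer.aestronglyMeasurable
    (Eventually.of_forall fun w => by
      rw [norm_of_nonneg (fejer_nonneg w)]; exact fejer_le w)

lemma integral_fejer_pos : 0 < ∫ w, fejer w := by
  rw [integral_pos_iff_support_of_nonneg fejer_nonneg integrable_fejer]
  refine lt_of_lt_of_le ?_ (measure_mono (s := Set.Ioo 0 π) fun w hw => ?_)
  · simp [pi_pos]
  · have h1 : cos w < 1 := by
      simpa using cos_lt_cos_of_nonneg_of_le_pi le_rfl hw.2.le hw.1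
    have h2 : 0 < w := hw.1
    have : 0 < fejer w := by unfold fejer; apply div_pos <;> [linarith; positivity]
    exact this.ne'

lemma tendsto_integral_fejer_Icc :
    Tendsto (fun R : ℝ => ∫ w in Set.Icc (-R) R, fejer w) atTop (𝓝 (∫ w, fejer w)) := by
  have := (aecover_Icc (μ := (volume : Measure ℝ)) (a := fun R : ℝ => -R) (b := fun R => R)
    tendsto_neg_atTop_atBot tendsto_id).integral_tendsto_of_countably_generated integrable_fejer
  exact this

lemma integral_mul_fejer_eq_integral_tent {g : ℝ → ℝ} {M : ℝ} (hg : Measurable g)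
    (hM : ∀ t, |g t| ≤ M) {G : ℂ → ℂ}
    (hG : ∀ s : ℂ, 0 < s.re → ∫ t in Set.Ioi (0 : ℝ), (g t : ℂ) * Complex.exp (-s * t) = G s)
    {l δ : ℝ} (hl : 0 < l) (hδ : 0 < δ) (u : ℝ) :
    ∫ t in Set.Ioi (0 : ℝ), ((g t * exp (-δ * t) * fejer (l * (u - t)) : ℝ) : ℂ) =
      ∫ x : ℝ, (tent x : ℂ) * Complex.exp (Complex.I * (l * u) * x) *
        G (δ + Complex.I * (l * x)) := by
  have hM0 : 0 ≤ M := (abs_nonneg _).trans (hM 0)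
  have h1 : ∫ t in Set.Ioi (0 : ℝ), ((g t * exp (-δ * t) * fejer (l * (u - t)) : ℝ) : ℂ) =
      ∫ t in Set.Ioi (0 : ℝ), ∫ x : ℝ, ((g t * exp (-δ * t) : ℝ) : ℂ) *
        ((tent x : ℂ) * Complex.exp (Complex.I * ((l * (u - t) : ℝ) : ℂ) * x)) := by
    refine integral_congr_ae (ae_restrict_of_ae ?_)
    filter_upwards [compl_mem_ae_iff.2 (measure_singleton u)] with t ht
    have ht' : l * (u - t) ≠ 0 := mul_ne_zero hl.ne' (sub_ne_zero.2 fun h => ht (by simp [h]))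
    rw [integral_const_mul, integral_tent_mul_cexp ht']
    push_cast
    ring
  rw [h1, integral_integral_swap]
  · refine integral_congr_ae (Eventually.of_forall fun x => ?_)
    simp only
    rw [← hG _ (by simpa using hδ), ← integral_const_mul]
    refine integral_congr_ae (Eventually.of_forall fun t => ?_)
    simp only
    have h2 : Complex.exp (Complex.I * ((l * (u - t) : ℝ) : ℂ) * x) =
        Complex.exp (Complex.I * (l * u) * x) * Complex.exp (-(Complex.I * (l * x)) * t) := by
      rw [← Complex.exp_add]; congr 1; push_cast; ring
    have h3 : Complex.exp (-(δ + Complex.I * (l * x)) * t) =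
        Complex.exp (-δ * t) * Complex.exp (-(Complex.I * (l * x)) * t) := by
      rw [← Complex.exp_add]; congr 1; ring
    rw [h2, h3]
    push_cast
    ring
  · have hint : Integrable (fun z : ℝ × ℝ => (M * exp (-δ * z.1)) * tent z.2)
        ((volume.restrict (Set.Ioi (0 : ℝ))).prod volume) :=
      Integrable.mul_prod ((integrableOn_exp_mul_Ioi (a := -δ) (by linarith) 0).const_mul M)
        integrable_tent
    refine hint.mono' ?_ (Eventually.of_forall fun z => ?_)
    · have := continuous_tent.measurable
      refine Measurable.aestronglyMeasurable ?_
      simp only [Function.uncurry_def]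
      fun_prop
    · have h4 : ‖Complex.exp (Complex.I * ((l * (u - z.1) : ℝ) : ℂ) * z.2)‖ = 1 := by
        rw [Complex.norm_exp]; simp
      simp only [Function.uncurry_def, norm_mul, h4, mul_one, Complex.norm_real, Real.norm_eq_abs,
        abs_exp, abs_of_nonneg (tent_nonneg _)]
      gcongr
      · exact tent_nonneg _
      · exact hM _

lemma integral_mul_fejer_eq_integral_tent_boundary {g : ℝ → ℝ} {M : ℝ} (hg : Measurable g)
    (hM : ∀ t, |g t| ≤ M) {G : ℂ → ℂ} (hGc : ContinuousOn G {s | 0 ≤ s.re})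
    (hG : ∀ s : ℂ, 0 < s.re → ∫ t in Set.Ioi (0 : ℝ), (g t : ℂ) * Complex.exp (-s * t) = G s)
    {l : ℝ} (hl : 0 < l) (u : ℝ) :
    ∫ t in Set.Ioi (0 : ℝ), ((g t * fejer (l * (u - t)) : ℝ) : ℂ) =
      ∫ x : ℝ, (tent x : ℂ) * Complex.exp (Complex.I * (l * u) * x) *
        G (Complex.I * (l * x)) := by
  have hM0 : 0 ≤ M := (abs_nonneg _).trans (hM 0)
  have hfe : Integrable fun t => fejer (l * (u - t)) :=
    (integrable_fejer.comp_mul_left' hl.ne').comp_sub_left u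
  have hmf := measurable_fejer
  have hlhs : Tendsto (fun δ : ℝ => ∫ t in Set.Ioi (0 : ℝ),
      ((g t * exp (-δ * t) * fejer (l * (u - t)) : ℝ) : ℂ)) (𝓝[>] 0)
      (𝓝 (∫ t in Set.Ioi (0 : ℝ), ((g t * fejer (l * (u - t)) : ℝ) : ℂ))) := by
    refine tendsto_integral_filter_of_dominated_convergence (fun t => M * fejer (l * (u - t)))
      (Eventually.of_forall fun δ => Measurable.aestronglyMeasurable (by fun_prop)) ?_
      (hfe.const_mul M).integrableOn ?_
    · filter_upwards [self_mem_nhdsWithin] with δ (hδ : 0 < δ)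
      filter_upwards [ae_restrict_mem measurableSet_Ioi] with t (ht : 0 < t)
      rw [Complex.norm_real, norm_mul, norm_mul, norm_of_nonneg (fejer_nonneg _),
        norm_of_nonneg (exp_pos _).le, Real.norm_eq_abs]
      have : exp (-δ * t) ≤ 1 := by
        rw [exp_le_one_iff]; nlinarith
      gcongr
      · exact fejer_nonneg _
      · calc |g t| * exp (-δ * t) ≤ M * 1 := by gcongr; exact hM t
          _ = M := mul_one M
    · refine Eventually.of_forall fun t => ?_
      have : Tendsto (fun δ : ℝ => ((g t * exp (-δ * t) * fejer (l * (u - t)) : ℝ) : ℂ)) (𝓝 0)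
          (𝓝 ((g t * exp (-0 * t) * fejer (l * (u - t)) : ℝ) : ℂ)) :=
        Continuous.tendsto (by fun_prop) 0
      simpa using this.mono_left nhdsWithin_le_nhds
  obtain ⟨D, hD⟩ : ∃ D, ∀ δ ∈ Set.Icc (0 : ℝ) 1, ∀ x ∈ Set.Icc (-1 : ℝ) 1,
      ‖G (δ + Complex.I * (l * x))‖ ≤ D := by
    have hcomp : IsCompact (Set.Icc (0 : ℝ) 1 ×ˢ Set.Icc (-1 : ℝ) 1) :=
      isCompact_Icc.prod isCompact_Icc
    obtain ⟨D, hD⟩ := hcomp.exists_bound_of_continuousOn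
      (f := fun z : ℝ × ℝ => G (z.1 + Complex.I * (l * z.2)))
      (hGc.comp (Continuous.continuousOn (by fun_prop)) fun z hz => by simpa using hz.1.1)
    exact ⟨D, fun δ hδ x hx => hD (δ, x) ⟨hδ, hx⟩⟩
  have hGline (δ : ℝ) (hδ : 0 ≤ δ) : Continuous fun x : ℝ => G (δ + Complex.I * (l * x)) :=
    hGc.comp_continuous (by fun_prop) fun x => by simpa using hδ
  have hten := continuous_tent
  have hrhs : Tendsto (fun δ : ℝ => ∫ x : ℝ, (tent x : ℂ) * Complex.exp (Complex.I * (l * u) * x) *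
        G (δ + Complex.I * (l * x))) (𝓝[>] 0) (𝓝 (∫ x : ℝ, (tent x : ℂ) *
        Complex.exp (Complex.I * (l * u) * x) * G (Complex.I * (l * x)))) := by
    refine tendsto_integral_filter_of_dominated_convergence (fun x => tent x * D) ?_ ?_
      (integrable_tent.mul_const D) ?_
    · filter_upwards [self_mem_nhdsWithin] with δ (hδ : 0 < δ)
      exact (Continuous.mul (by fun_prop) (hGline δ hδ.le)).aestronglyMeasurable
    · filter_upwards [self_mem_nhdsWithin, nhdsWithin_le_nhds (Iic_mem_nhds one_pos)]
        with δ (hδ : 0 < δ) (hδ1 : δ ≤ 1)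
      refine Eventually.of_forall fun x => ?_
      have h4 : ‖Complex.exp (Complex.I * (l * u) * x)‖ = 1 := by
        rw [Complex.norm_exp]; simp
      rw [norm_mul, norm_mul, h4, mul_one, Complex.norm_real, norm_of_nonneg (tent_nonneg _)]
      by_cases hx : 1 ≤ |x|
      · simp [tent_eq_zero hx]
      · exact mul_le_mul_of_nonneg_left (hD δ ⟨hδ.le, hδ1⟩ x (abs_le.1 (not_le.1 hx).le))
          (tent_nonneg _)
    · refine Eventually.of_forall fun x => ?_
      refine Tendsto.const_mul _ ?_
      refine (hGc _ (by simp)).tendsto.comp (tendsto_nhdsWithin_iff.2 ⟨?_, ?_⟩)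
      · have : Tendsto (fun δ : ℝ => (δ : ℂ) + Complex.I * (l * x)) (𝓝 0)
            (𝓝 (((0 : ℝ) : ℂ) + Complex.I * (l * x))) := Continuous.tendsto (by fun_prop) 0
        simpa using this.mono_left nhdsWithin_le_nhds
      · filter_upwards [self_mem_nhdsWithin] with δ (hδ : 0 < δ)
        simpa using hδ.le
  refine tendsto_nhds_unique hlhs (hrhs.congr' ?_)
  filter_upwards [self_mem_nhdsWithin] with δ (hδ : 0 < δ)
  exact (integral_mul_fejer_eq_integral_tent hg hM hG hl hδ u).symm

lemma tendsto_integral_comp_sub_mul_fejer {g : ℝ → ℝ} {M : ℝ} (hg : Measurable g)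
    (hM : ∀ t, |g t| ≤ M) (hg0 : ∀ t ≤ 0, g t = 0) {G : ℂ → ℂ}
    (hGc : ContinuousOn G {s | 0 ≤ s.re})
    (hG : ∀ s : ℂ, 0 < s.re → ∫ t in Set.Ioi (0 : ℝ), (g t : ℂ) * Complex.exp (-s * t) = G s)
    {l : ℝ} (hl : 0 < l) :
    Tendsto (fun u : ℝ => ∫ w, g (u - w / l) * fejer w) atTop (𝓝 0) := by
  have hRL := Real.tendsto_integral_exp_smul_cocompact
    (fun x : ℝ => (tent x : ℂ) * G (Complex.I * (l * x)))
  have hlim : Tendsto (fun u : ℝ => -(l * u) / (2 * π)) atTop (cocompact ℝ) := by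
    refine Tendsto.mono_right ?_ atBot_le_cocompact
    refine Tendsto.atBot_div_const (by positivity) ?_
    exact tendsto_neg_atTop_atBot.comp (tendsto_id.const_mul_atTop hl)
  have hzero := (hRL.comp hlim).const_mul (l : ℂ)
  rw [mul_zero] at hzero
  have hcast : Tendsto (fun u : ℝ => ((∫ w, g (u - w / l) * fejer w : ℝ) : ℂ)) atTop
      (𝓝 ((0 : ℝ) : ℂ)) := by
    rw [Complex.ofReal_zero]
    refine hzero.congr fun u => ?_
    have h1 : ∫ w, g (u - w / l) * fejer w = l * ∫ t, g t * fejer (l * (u - t)) := by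
      rw [← integral_sub_left_eq_self (fun t => g t * fejer (l * (u - t))) volume u]
      have := Measure.integral_comp_div (fun w => g (u - w) * fejer (l * w)) l
      simp only [abs_of_pos hl, smul_eq_mul, mul_div_cancel₀ _ hl.ne'] at this
      simpa using this
    have h2 : ∫ t, g t * fejer (l * (u - t)) =
        ∫ t in Set.Ioi (0 : ℝ), g t * fejer (l * (u - t)) := by
      rw [setIntegral_eq_integral_of_forall_compl_eq_zero]
      intro t ht
      rw [hg0 t (not_lt.1 ht), zero_mul]
    rw [h1, h2, Complex.ofReal_mul, ← integral_complex_ofReal,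
      integral_mul_fejer_eq_integral_tent_boundary hg hM hGc hG hl u, Function.comp_apply]
    congr 1
    refine integral_congr_ae (Eventually.of_forall fun x => ?_)
    simp only [Circle.smul_def, Real.fourierChar_apply, smul_eq_mul]
    have : Complex.exp (2 * π * ((-(x * (-(l * u) / (2 * π))) : ℝ) : ℂ) * Complex.I) =
        Complex.exp (Complex.I * (l * u) * x) := by
      congr 1
      have : (π : ℂ) ≠ 0 := by exact_mod_cast pi_ne_zero
      push_cast
      field_simp
    push_cast at this ⊢
    rw [this]
    ring
  exact tendsto_ofReal_iff.1 hcast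

lemma tendsto_one_of_tendsto_integral_fejer {B : ℝ → ℝ} {M : ℝ} (hB : Measurable B)
    (hB0 : ∀ t, 0 ≤ B t) (hM : ∀ t, B t ≤ M) (hmono : Monotone fun t => exp t * B t)
    (hlim : ∀ l : ℝ, 0 < l →
      Tendsto (fun u : ℝ => ∫ w, B (u - w / l) * fejer w) atTop (𝓝 (∫ w, fejer w))) :
    Tendsto B atTop (𝓝 1) := by
  set c := ∫ w, fejer w with hc
  have hc0 : 0 < c := integral_fejer_pos
  have hint (l u : ℝ) : Integrable fun w => B (u - w / l) * fejer w := by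
    have hf := measurable_fejer
    refine (integrable_fejer.const_mul M).mono' (Measurable.aestronglyMeasurable (by fun_prop))
      (Eventually.of_forall fun w => ?_)
    rw [norm_of_nonneg (mul_nonneg (hB0 _) (fejer_nonneg _))]
    exact mul_le_mul_of_nonneg_right (hM _) (fejer_nonneg _)
  have hcomp {s t : ℝ} (hst : s ≤ t) : B s ≤ exp (t - s) * B t := by
    have := hmono hst
    simp only at this
    rw [exp_sub, div_mul_eq_mul_div, le_div_iff₀ (exp_pos s), mul_comm]
    exact this
  have hwin {η R w u : ℝ} (hη : 0 < η) (hR : 0 < R) (hw : w ∈ Set.Icc (-R) R) :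
      u - η ≤ u - w / (R / η) ∧ u - w / (R / η) ≤ u + η := by
    have h : w / (R / η) = w / R * η := by field_simp
    have h1 : w / R ≤ 1 := (div_le_one hR).2 hw.2
    have h2 : -1 ≤ w / R := by rw [le_div_iff₀ hR]; linarith [hw.1]
    rw [h]
    constructor <;> nlinarith
  have hexp (a : ℝ) (ha : 1 < a) : ∃ η > 0, exp (2 * η) < a := by
    refine ⟨log a / 4, by have := log_pos ha; positivity, ?_⟩
    rw [← lt_log_iff_exp_lt (by linarith)]
    linarith [log_pos ha]
  refine tendsto_order.2 ⟨fun a ha => ?_, fun a ha => ?_⟩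
  · obtain ⟨η, hη, hηa⟩ : ∃ η > 0, exp (2 * η) * a < 1 := by
      rcases le_or_gt a 0 with ha0 | ha0
      · exact ⟨1, one_pos, by nlinarith [exp_pos (2 * 1)]⟩
      · obtain ⟨η, hη, h⟩ := hexp a⁻¹ (by rw [one_lt_inv₀ ha0]; exact ha)
        exact ⟨η, hη, by rwa [lt_inv_comm₀ (exp_pos _) ha0, ← one_div, lt_div_iff₀ (exp_pos _),
          mul_comm] at h⟩
    have hR : ∀ᶠ R : ℝ in atTop, exp (2 * η) * a * c +
        M * (c - ∫ w in Set.Icc (-R) R, fejer w) < c := by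
      have : Tendsto (fun R : ℝ => exp (2 * η) * a * c +
          M * (c - ∫ w in Set.Icc (-R) R, fejer w)) atTop
          (𝓝 (exp (2 * η) * a * c + M * (c - c))) :=
        ((tendsto_integral_fejer_Icc.const_sub c).const_mul M).const_add _
      refine (tendsto_order.1 this).2 c ?_
      nlinarith
    obtain ⟨R, hRlt, hR0⟩ := (hR.and (eventually_gt_atTop 0)).exists
    have hl : 0 < R / η := div_pos hR0 hη
    have hev := (tendsto_order.1 (hlim _ hl)).1 _ hRlt
    have hshift := (tendsto_atTop_add_const_right atTop (-η) tendsto_id).eventually hev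
    filter_upwards [hshift] with v hv
    simp only [id_eq] at hv
    set u := v + -η with hu
    have hupper : ∫ w, B (u - w / (R / η)) * fejer w ≤
        exp (2 * η) * B v * c + M * (c - ∫ w in Set.Icc (-R) R, fejer w) := by
      rw [← integral_add_compl measurableSet_Icc (hint _ _) (s := Set.Icc (-R) R)]
      have hsplit := integral_add_compl (s := Set.Icc (-R) R) measurableSet_Icc integrable_fejer
      refine add_le_add ?_ ?_
      · calc ∫ w in Set.Icc (-R) R, B (u - w / (R / η)) * fejer w
            ≤ ∫ w in Set.Icc (-R) R, exp (2 * η) * B v * fejer w := by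
              refine setIntegral_mono_on (hint _ _).integrableOn
                (integrable_fejer.const_mul _).integrableOn measurableSet_Icc fun w hw => ?_
              refine mul_le_mul_of_nonneg_right ?_ (fejer_nonneg w)
              obtain ⟨h1, h2⟩ := hwin (u := u) hη hR0 hw
              have h3 : u + η = v := by rw [hu]; ring
              refine (hcomp (h2.trans h3.le)).trans (mul_le_mul_of_nonneg_right ?_ (hB0 _))
              exact exp_le_exp.2 (by linarith)
          _ = exp (2 * η) * B v * ∫ w in Set.Icc (-R) R, fejer w := integral_const_mul _ _
          _ ≤ exp (2 * η) * B v * c := by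
              refine mul_le_mul_of_nonneg_left ?_ (mul_nonneg (exp_pos _).le (hB0 v))
              exact setIntegral_le_integral integrable_fejer
                (Eventually.of_forall fejer_nonneg)
      · calc ∫ w in (Set.Icc (-R) R)ᶜ, B (u - w / (R / η)) * fejer w
            ≤ ∫ w in (Set.Icc (-R) R)ᶜ, M * fejer w := by
              refine integral_mono (hint _ _).integrableOn
                (integrable_fejer.const_mul _).integrableOn fun w => ?_
              exact mul_le_mul_of_nonneg_right (hM _) (fejer_nonneg w)
          _ = M * ∫ w in (Set.Icc (-R) R)ᶜ, fejer w := integral_const_mul _ _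
          _ = _ := by rw [hc, ← hsplit]; ring
    have h4 : exp (2 * η) * c * a < exp (2 * η) * c * B v := by linarith
    exact lt_of_mul_lt_mul_left h4 (by positivity)
  · obtain ⟨η, hη, hηa⟩ := hexp a ha
    have ha0 : 0 < a := by linarith
    have hR : ∀ᶠ R : ℝ in atTop, exp (2 * η) * c < a * ∫ w in Set.Icc (-R) R, fejer w :=
      (tendsto_order.1 (tendsto_integral_fejer_Icc.const_mul a)).1 _
        (mul_lt_mul_of_pos_right hηa hc0)
    obtain ⟨R, hRlt, hR0⟩ := (hR.and (eventually_gt_atTop 0)).exists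
    have hl : 0 < R / η := div_pos hR0 hη
    have hev := (tendsto_order.1 ((hlim _ hl).const_mul (exp (2 * η)))).2 _ hRlt
    have hshift := (tendsto_atTop_add_const_right atTop η tendsto_id).eventually hev
    filter_upwards [hshift] with v hv
    simp only [id_eq] at hv
    set u := v + η with hu
    have hlower : B v * ∫ w in Set.Icc (-R) R, fejer w ≤
        exp (2 * η) * ∫ w, B (u - w / (R / η)) * fejer w := by
      calc B v * ∫ w in Set.Icc (-R) R, fejer w
          = ∫ w in Set.Icc (-R) R, B v * fejer w := (integral_const_mul _ _).symm
        _ ≤ ∫ w in Set.Icc (-R) R, exp (2 * η) * (B (u - w / (R / η)) * fejer w) := by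
            refine setIntegral_mono_on (integrable_fejer.const_mul _).integrableOn
              ((hint _ _).const_mul _).integrableOn measurableSet_Icc fun w hw => ?_
            rw [← mul_assoc]
            refine mul_le_mul_of_nonneg_right ?_ (fejer_nonneg w)
            obtain ⟨h1, h2⟩ := hwin (u := u) hη hR0 hw
            have h3 : u - η = v := by rw [hu]; ring
            refine (hcomp (h3.symm.le.trans h1)).trans (mul_le_mul_of_nonneg_right ?_ (hB0 _))
            exact exp_le_exp.2 (by linarith)
        _ = exp (2 * η) * ∫ w in Set.Icc (-R) R, B (u - w / (R / η)) * fejer w :=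
            integral_const_mul _ _
        _ ≤ exp (2 * η) * ∫ w, B (u - w / (R / η)) * fejer w := by
            refine mul_le_mul_of_nonneg_left ?_ (exp_pos _).le
            exact setIntegral_le_integral (hint _ _)
              (Eventually.of_forall fun w => mul_nonneg (hB0 _) (fejer_nonneg w))
    exact lt_of_mul_lt_mul_right (hlower.trans_lt hv) (setIntegral_nonneg measurableSet_Icc
      fun w _ => fejer_nonneg w)

lemma sum_Icc_vonMangoldt_eq_psi (t : ℝ) :
    ∑ k ∈ Finset.Icc 1 ⌊t⌋₊, ArithmeticFunction.vonMangoldt k = Chebyshev.psi t := rfl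

lemma exists_psi_le_mul : ∃ M : ℝ, 1 ≤ M ∧ ∀ x : ℝ, 0 ≤ x → Chebyshev.psi x ≤ M * x :=
  ⟨max (log 4 + 4) 1, le_max_right _ _, fun _ hx => (Chebyshev.psi_le_const_mul_self hx).trans
    (mul_le_mul_of_nonneg_right (le_max_left _ _) hx)⟩

lemma LSeries_vonMangoldt_eq_integral_exp {s : ℂ} (hs : 0 < s.re) :
    LSeries (fun n => (ArithmeticFunction.vonMangoldt n : ℂ)) (1 + s) =
      (1 + s) * ∫ t in Set.Ioi (0 : ℝ),
        ((Chebyshev.psi (exp t) * exp (-t) : ℝ) : ℂ) * Complex.exp (-s * t) := by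
  obtain ⟨M, hM1, hM⟩ := exists_psi_le_mul
  have hO : (fun n : ℕ => ∑ k ∈ Finset.Icc 1 n, ArithmeticFunction.vonMangoldt k) =O[atTop]
      fun n => (n : ℝ) ^ (1 : ℝ) := by
    refine IsBigO.of_bound M (Eventually.of_forall fun n => ?_)
    have h1 := sum_Icc_vonMangoldt_eq_psi n
    rw [Nat.floor_natCast] at h1
    rw [h1, rpow_one, norm_of_nonneg (Chebyshev.psi_nonneg _), norm_of_nonneg (Nat.cast_nonneg n)]
    exact hM n (Nat.cast_nonneg n)
  rw [LSeries_eq_mul_integral_of_nonneg (fun n => ArithmeticFunction.vonMangoldt n) zero_le_one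
    (s := 1 + s) (by simpa using hs) hO (fun n => ArithmeticFunction.vonMangoldt_nonneg)]
  congr 1
  have himage : exp '' Set.Ioi (0 : ℝ) = Set.Ioi 1 := by
    ext x
    constructor
    · rintro ⟨t, ht, rfl⟩
      exact one_lt_exp_iff.2 ht
    · intro hx
      exact ⟨log x, log_pos hx, exp_log (zero_lt_one.trans hx)⟩
  rw [← himage, integral_image_eq_integral_abs_deriv_smul measurableSet_Ioi
    (fun x _ => (hasDerivAt_exp x).hasDerivWithinAt) exp_injective.injOn]
  refine integral_congr_ae (Eventually.of_forall fun t => ?_)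
  simp only
  have h2 : ∑ k ∈ Finset.Icc 1 ⌊exp t⌋₊, (ArithmeticFunction.vonMangoldt k : ℂ) =
      (Chebyshev.psi (exp t) : ℂ) := by
    rw [← sum_Icc_vonMangoldt_eq_psi]; push_cast; rfl
  have h3 : ((exp t : ℝ) : ℂ) ^ (-(1 + s + 1)) =
      Complex.exp (-(t : ℂ)) * Complex.exp (-(t : ℂ)) * Complex.exp (-s * t) := by
    rw [Complex.cpow_def_of_ne_zero (by exact_mod_cast (exp_pos t).ne'), ← Complex.ofReal_log
      (exp_pos t).le, log_exp, ← Complex.exp_add, ← Complex.exp_add]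
    congr 1
    ring
  have h4 : (Complex.exp (t : ℂ)) * Complex.exp (-(t : ℂ)) = 1 := by
    rw [← Complex.exp_add]; simp
  rw [h2, h3, abs_of_pos (exp_pos t), Complex.real_smul]
  push_cast
  linear_combination (Complex.exp (-(t : ℂ)) * Complex.exp (-s * t) *
    (Chebyshev.psi (exp t) : ℂ)) * h4

lemma exists_continuousOn_eq_LSeries_vonMangoldt :
    ∃ F : ℂ → ℂ, ContinuousOn F {s | 1 ≤ s.re} ∧ ∀ s : ℂ, 1 < s.re →
      F s = LSeries (fun n => (ArithmeticFunction.vonMangoldt n : ℂ)) s - 1 / (s - 1) := by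
  refine ⟨ArithmeticFunction.vonMangoldt.LFunctionResidueClassAux (1 : ZMod 1),
    ArithmeticFunction.vonMangoldt.continuousOn_LFunctionResidueClassAux 1, fun s hs => ?_⟩
  rw [ArithmeticFunction.vonMangoldt.eqOn_LFunctionResidueClassAux isUnit_one hs]
  have : ArithmeticFunction.vonMangoldt.residueClass (1 : ZMod 1) =
      fun n => ArithmeticFunction.vonMangoldt n := by
    ext n
    simp [ArithmeticFunction.vonMangoldt.residueClass, Set.indicator,
      Subsingleton.elim (n : ZMod 1) 1]
  simp [this]

lemma tendsto_psi_exp_mul_exp_neg :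
    Tendsto (fun t : ℝ => Chebyshev.psi (exp t) * exp (-t)) atTop (𝓝 1) := by
  obtain ⟨M, hM1, hM⟩ := exists_psi_le_mul
  obtain ⟨F, hFc, hF⟩ := exists_continuousOn_eq_LSeries_vonMangoldt
  set B : ℝ → ℝ := fun t => Chebyshev.psi (exp t) * exp (-t) with hBdef
  have hBm : Measurable B :=
    (Chebyshev.psi_mono.measurable.comp measurable_exp).mul (by fun_prop)
  have hB0 (t : ℝ) : 0 ≤ B t := mul_nonneg (Chebyshev.psi_nonneg _) (exp_pos _).le
  have hBM (t : ℝ) : B t ≤ M := by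
    have := mul_le_mul_of_nonneg_right (hM (exp t) (exp_pos t).le) (exp_pos (-t)).le
    rwa [mul_assoc, ← exp_add, add_neg_cancel, exp_zero, mul_one] at this
  set e : ℝ → ℝ := Set.indicator (Set.Ioi 0) 1 with he
  have hem : Measurable e := measurable_one.indicator measurableSet_Ioi
  have he0 (t : ℝ) : 0 ≤ e t := Set.indicator_nonneg (fun _ _ => zero_le_one) t
  have he1 (t : ℝ) : e t ≤ 1 := Set.indicator_le_self' (fun _ _ => zero_le_one) t
  have hmul (t : ℝ) : exp t * B t = Chebyshev.psi (exp t) := by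
    simp only [hBdef]
    rw [mul_left_comm, ← exp_add, add_neg_cancel, exp_zero, mul_one]
  have hf := measurable_fejer
  refine tendsto_one_of_tendsto_integral_fejer hBm hB0 hBM ?_ fun l hl => ?_
  · intro s t hst
    simp only [hmul]
    exact Chebyshev.psi_mono (exp_le_exp.2 hst)
  have hone : Tendsto (fun u : ℝ => ∫ w, e (u - w / l) * fejer w) atTop (𝓝 (∫ w, fejer w)) := by
    refine tendsto_integral_filter_of_dominated_convergence fejer
      (Eventually.of_forall fun u => Measurable.aestronglyMeasurable (by fun_prop))
      (Eventually.of_forall fun u => Eventually.of_forall fun w => ?_) integrable_fejer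
      (Eventually.of_forall fun w => ?_)
    · rw [norm_of_nonneg (mul_nonneg (he0 _) (fejer_nonneg w))]
      exact mul_le_of_le_one_left (fejer_nonneg w) (he1 _)
    · refine tendsto_const_nhds.congr' ?_
      filter_upwards [eventually_gt_atTop (w / l)] with u hu
      simp [he, hu]
  have hdiff : Tendsto (fun u : ℝ => ∫ w, (B (u - w / l) - e (u - w / l)) * fejer w) atTop
      (𝓝 0) := by
    refine tendsto_integral_comp_sub_mul_fejer (g := fun t => B t - e t) (M := M + 1)
      (hBm.sub hem) (fun t => ?_) (fun t ht => ?_)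
      (G := fun s => (F (1 + s) - 1) / (1 + s)) ?_ (fun s hs => ?_) hl
    · rw [abs_le]
      constructor <;> linarith [hB0 t, hBM t, he0 t, he1 t]
    · have : exp t ≤ 1 := exp_le_one_iff.2 ht
      simp [hBdef, he, Chebyshev.psi_eq_zero_of_le_one this, ht]
    · refine ContinuousOn.div (ContinuousOn.sub (hFc.comp (by fun_prop) ?_) continuousOn_const)
        (by fun_prop) fun s hs h => ?_
      · intro s (hs : 0 ≤ s.re)
        simpa using hs
      · have := congrArg Complex.re h
        simp only [Complex.add_re, Complex.one_re, Complex.zero_re] at this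
        have : 0 ≤ s.re := hs
        linarith
    · have hs0 : s ≠ 0 := fun h => by simp [h] at hs
      have hs1 : 1 + s ≠ 0 := fun h => by
        have := congrArg Complex.re h
        simp only [Complex.add_re, Complex.one_re, Complex.zero_re] at this
        linarith
      have hexp_int := integrableOn_exp_mul_complex_Ioi (a := -s) (by simpa using hs) 0
      have hBint : IntegrableOn (fun t : ℝ => (B t : ℂ) * Complex.exp (-s * t)) (Set.Ioi 0) := by
        refine (hexp_int.norm.const_mul M).mono'
          (Measurable.aestronglyMeasurable (by fun_prop)) (Eventually.of_forall fun t => ?_)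
        rw [norm_mul, Complex.norm_real, norm_of_nonneg (hB0 t)]
        exact mul_le_mul_of_nonneg_right (hBM t) (norm_nonneg _)
      have hsplit : ∫ t in Set.Ioi (0 : ℝ), ((B t - e t : ℝ) : ℂ) * Complex.exp (-s * t) =
          (∫ t in Set.Ioi (0 : ℝ), (B t : ℂ) * Complex.exp (-s * t)) -
            ∫ t in Set.Ioi (0 : ℝ), Complex.exp (-s * t) := by
        rw [← integral_sub hBint hexp_int]
        refine setIntegral_congr_fun measurableSet_Ioi fun t ht => ?_
        have : e t = 1 := by simp only [he, Set.indicator, ht, if_true, Pi.one_apply]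
        simp only [this]
        push_cast
        ring
      have hL := LSeries_vonMangoldt_eq_integral_exp hs
      rw [hsplit, integral_exp_mul_complex_Ioi (by simpa using hs) 0,
        hF (1 + s) (by simpa using hs), hL]
      simp only [Complex.ofReal_zero, mul_zero, Complex.exp_zero, add_sub_cancel_left]
      field_simp
      ring
  have hsum := hdiff.add hone
  rw [zero_add] at hsum
  refine hsum.congr fun u => ?_
  rw [← integral_add]
  · congr 1
    ext w
    ring
  · refine (integrable_fejer.const_mul (M + 1)).mono'
      (Measurable.aestronglyMeasurable (by fun_prop)) (Eventually.of_forall fun w => ?_)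
    rw [norm_mul, norm_of_nonneg (fejer_nonneg w)]
    refine mul_le_mul_of_nonneg_right (abs_le.2 ?_) (fejer_nonneg w)
    constructor <;> linarith [hB0 (u - w / l), hBM (u - w / l), he0 (u - w / l), he1 (u - w / l)]
  · refine integrable_fejer.mono' (Measurable.aestronglyMeasurable (by fun_prop))
      (Eventually.of_forall fun w => ?_)
    rw [norm_of_nonneg (mul_nonneg (he0 _) (fejer_nonneg w))]
    exact mul_le_of_le_one_left (fejer_nonneg w) (he1 _)

lemma tendsto_psi_div_self : Tendsto (fun x : ℝ => Chebyshev.psi x / x) atTop (𝓝 1) := by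
  refine (tendsto_psi_exp_mul_exp_neg.comp tendsto_log_atTop).congr' ?_
  filter_upwards [eventually_gt_atTop 0] with x hx
  rw [Function.comp_apply, exp_neg, exp_log hx, div_eq_mul_inv]

/-- The **prime number theorem**. -/
theorem tendsto_primeCounting_mul_log_div_self :
    Tendsto (fun x : ℝ => (Nat.primeCounting ⌊x⌋₊ : ℝ) * log x / x) atTop (𝓝 1) := by
  have h1 : Tendsto (fun x : ℝ => (Chebyshev.psi x - Chebyshev.theta x) / x) atTop (𝓝 0) := by
    refine IsLittleO.tendsto_div_nhds_zero (Chebyshev.isBigO_psi_sub_theta_sqrt.trans_isLittleO ?_)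
    rw [isLittleO_iff_tendsto' (by filter_upwards [eventually_gt_atTop 0] with x hx h; linarith)]
    refine (tendsto_sqrt_atTop.inv_tendsto_atTop).congr fun x => ?_
    rw [Pi.inv_apply, sqrt_div_self]
  have h2 : Tendsto (fun x : ℝ => Chebyshev.theta x / x) atTop (𝓝 1) := by
    have := tendsto_psi_div_self.sub h1
    rw [sub_zero] at this
    refine this.congr fun x => ?_
    ring
  have h3 : Tendsto (fun x : ℝ => (∫ t in (2 : ℝ)..x, Chebyshev.theta t / (t * log t ^ 2)) /
      (x / log x)) atTop (𝓝 0) :=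
    Chebyshev.integral_theta_div_log_sq_isLittleO.tendsto_div_nhds_zero
  have h4 := h2.add h3
  rw [add_zero] at h4
  refine h4.congr' ?_
  filter_upwards [eventually_ge_atTop 2] with x hx
  have hlog : 0 < log x := log_pos (by linarith)
  have hx0 : 0 < x := by linarith
  rw [Chebyshev.primeCounting_eq_theta_div_log_add_integral hx]
  field_simp

/-- The positive integers `n ≤ y` with exactly `k` prime factors, counted with multiplicity. -/
noncomputable def almostPrimesLE (k : ℕ) (y : ℝ) : Finset ℕ :=
  {n ∈ Finset.Icc 1 ⌊y⌋₊ | Ω n = k}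

/-- The number of positive integers `n ≤ y` with exactly `k` prime factors, counted with
multiplicity. -/
noncomputable def apCount (k : ℕ) (y : ℝ) : ℝ :=
  (almostPrimesLE k y).card

lemma mem_almostPrimesLE {k n : ℕ} {y : ℝ} :
    n ∈ almostPrimesLE k y ↔ n ≠ 0 ∧ (n : ℝ) ≤ y ∧ Ω n = k := by
  rw [almostPrimesLE, Finset.mem_filter, Finset.mem_Icc, Nat.one_le_iff_ne_zero]
  constructor
  · rintro ⟨⟨h0, h1⟩, h2⟩
    exact ⟨h0, (Nat.le_floor_iff' h0).1 h1, h2⟩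
  · rintro ⟨h0, h1, h2⟩
    exact ⟨⟨h0, (Nat.le_floor_iff' h0).2 h1⟩, h2⟩

lemma apCount_nonneg (k : ℕ) (y : ℝ) : 0 ≤ apCount k y := Nat.cast_nonneg _

lemma apCount_mono (k : ℕ) : Monotone (apCount k) := by
  intro y z hyz
  refine Nat.cast_le.2 (Finset.card_le_card fun n hn => ?_)
  rw [mem_almostPrimesLE] at hn ⊢
  exact ⟨hn.1, hn.2.1.trans hyz, hn.2.2⟩

lemma apCount_eq_zero_of_lt_one {k : ℕ} {y : ℝ} (hy : y < 1) : apCount k y = 0 := by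
  rw [apCount, Nat.cast_eq_zero, Finset.card_eq_zero, Finset.eq_empty_iff_forall_notMem]
  intro n hn
  rw [mem_almostPrimesLE] at hn
  have : (1 : ℝ) ≤ n := by exact_mod_cast Nat.one_le_iff_ne_zero.2 hn.1
  linarith [hn.2.1]

lemma apCount_zero {y : ℝ} (hy : 1 ≤ y) : apCount 0 y = 1 := by
  have : almostPrimesLE 0 y = {1} := by
    ext n
    rw [mem_almostPrimesLE, Finset.mem_singleton]
    constructor
    · rintro ⟨h0, -, h⟩
      exact (ArithmeticFunction.cardFactors_eq_zero_iff_eq_zero_or_one.1 h).resolve_left h0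
    · rintro rfl
      simpa using hy
  rw [apCount, this, Finset.card_singleton, Nat.cast_one]

lemma apCount_one (y : ℝ) : apCount 1 y = Nat.primeCounting ⌊y⌋₊ := by
  rw [apCount, ← Nat.primesLE_card_eq_primeCounting]
  congr 2
  ext n
  rw [mem_almostPrimesLE, Nat.mem_primesLE, ArithmeticFunction.cardFactors_eq_one_iff_prime]
  constructor
  · rintro ⟨h0, h1, h2⟩
    exact ⟨(Nat.le_floor_iff' h0).2 h1, h2⟩
  · rintro ⟨h1, h2⟩
    exact ⟨h2.ne_zero, (Nat.le_floor_iff' h2.ne_zero).1 h1, h2⟩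

lemma card_filter_dvd_almostPrimesLE {k j d : ℕ} (y : ℝ) (hd : d ≠ 0) (hj : Ω d = j) :
    (({n ∈ almostPrimesLE (k + j) y | d ∣ n}.card : ℕ) : ℝ) = apCount k (y / d) := by
  have hd' : (0 : ℝ) < d := by exact_mod_cast Nat.pos_of_ne_zero hd
  rw [apCount, Nat.cast_inj, eq_comm]
  refine Finset.card_bij (fun m _ => d * m) (fun m hm => ?_)
    (fun a _ b _ hab => Nat.eq_of_mul_eq_mul_left (Nat.pos_of_ne_zero hd) hab) (fun n hn => ?_)
  · rw [mem_almostPrimesLE] at hm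
    rw [Finset.mem_filter, mem_almostPrimesLE, ArithmeticFunction.cardFactors_mul hd hm.1,
      hm.2.2, hj, add_comm]
    refine ⟨⟨mul_ne_zero hd hm.1, ?_, rfl⟩, dvd_mul_right _ _⟩
    rw [Nat.cast_mul, mul_comm]
    exact (le_div_iff₀ hd').1 hm.2.1
  · rw [Finset.mem_filter, mem_almostPrimesLE] at hn
    obtain ⟨⟨h0, hy, hk⟩, m, rfl⟩ := hn
    have hm : m ≠ 0 := right_ne_zero_of_mul h0
    rw [ArithmeticFunction.cardFactors_mul hd hm, hj] at hk
    refine ⟨m, mem_almostPrimesLE.2 ⟨hm, ?_, by omega⟩, rfl⟩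
    rw [le_div_iff₀ hd', mul_comm]
    exact_mod_cast hy

lemma sum_apCount_div_prime (k : ℕ) (y : ℝ) {N : ℕ} (hN : ⌊y⌋₊ ≤ N) :
    ∑ p ∈ N.primesLE, apCount k (y / p) =
      ∑ n ∈ almostPrimesLE (k + 1) y, (n.primeFactors.card : ℝ) := by
  have h1 : ∀ p ∈ N.primesLE, apCount k (y / p) =
      ((almostPrimesLE (k + 1) y).bipartiteAbove (fun p n => p ∣ n) p).card := fun p hp => by
    have hp' := Nat.prime_of_mem_primesLE hp
    rw [Finset.bipartiteAbove, card_filter_dvd_almostPrimesLE y hp'.ne_zero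
      (ArithmeticFunction.cardFactors_apply_prime hp')]
  rw [Finset.sum_congr rfl h1]
  norm_cast
  rw [Finset.sum_card_bipartiteAbove_eq_sum_card_bipartiteBelow]
  refine Finset.sum_congr rfl fun n hn => ?_
  congr 1
  rw [mem_almostPrimesLE] at hn
  ext p
  rw [Finset.mem_bipartiteBelow, Nat.mem_primesLE, Nat.mem_primeFactors_of_ne_zero hn.1]
  refine ⟨fun h => ⟨h.1.2, h.2⟩, fun h => ⟨⟨?_, h.1⟩, h.2⟩⟩
  exact (Nat.le_of_dvd (Nat.pos_of_ne_zero hn.1) h.2).trans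
    (((Nat.le_floor_iff' hn.1).2 hn.2.1).trans hN)

lemma apCount_succ_le_sum (k : ℕ) (y : ℝ) {N : ℕ} (hN : ⌊y⌋₊ ≤ N) :
    apCount (k + 1) y ≤ ∑ p ∈ N.primesLE, apCount k (y / p) := by
  rw [sum_apCount_div_prime k y hN, apCount, Finset.cast_card]
  refine Finset.sum_le_sum fun n hn => ?_
  rw [mem_almostPrimesLE] at hn
  rw [Nat.one_le_cast, Nat.one_le_iff_ne_zero, Ne, Finset.card_eq_zero, Nat.primeFactors_eq_empty]
  rintro (rfl | rfl)
  · exact hn.1 rfl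
  · simp at hn

lemma card_primeFactors_le_cardFactors (n : ℕ) : n.primeFactors.card ≤ Ω n :=
  List.toFinset_card_le _

lemma sum_apCount_le_succ (k : ℕ) (y : ℝ) {N : ℕ} (hN : ⌊y⌋₊ ≤ N) :
    ∑ p ∈ N.primesLE, apCount k (y / p) ≤ (k + 1) * apCount (k + 1) y := by
  rw [sum_apCount_div_prime k y hN, apCount, Finset.cast_card, Finset.mul_sum]
  refine Finset.sum_le_sum fun n hn => ?_
  rw [mem_almostPrimesLE] at hn
  have := card_primeFactors_le_cardFactors n
  rw [hn.2.2] at this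
  rw [mul_one]
  exact_mod_cast this

lemma succ_mul_apCount_le (k : ℕ) (y : ℝ) {N : ℕ} (hN : ⌊y⌋₊ ≤ N) :
    (k + 2) * apCount (k + 2) y ≤ ∑ p ∈ N.primesLE, apCount (k + 1) (y / p) +
      (k + 2) * ∑ p ∈ N.primesLE, apCount k (y / ((p ^ 2 : ℕ) : ℝ)) := by
  have h1 : ∀ p ∈ N.primesLE, apCount k (y / ((p ^ 2 : ℕ) : ℝ)) =
      ∑ n ∈ almostPrimesLE (k + 2) y, if p ^ 2 ∣ n then (1 : ℝ) else 0 := fun p hp => by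
    have hp' := Nat.prime_of_mem_primesLE hp
    rw [← card_filter_dvd_almostPrimesLE y (pow_ne_zero 2 hp'.ne_zero)
      (ArithmeticFunction.cardFactors_apply_prime_pow hp'), Finset.sum_boole]
  rw [sum_apCount_div_prime (k + 1) y hN, Finset.sum_congr rfl h1, Finset.sum_comm, apCount,
    Finset.cast_card, Finset.mul_sum, Finset.mul_sum, ← Finset.sum_add_distrib]
  refine Finset.sum_le_sum fun n hn => ?_
  rw [mem_almostPrimesLE] at hn
  rw [mul_one]
  by_cases hsq : Squarefree n
  · have h2 := (ArithmeticFunction.cardDistinctFactors_eq_cardFactors_iff_squarefree hn.1).2 hsq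
    rw [hn.2.2, ArithmeticFunction.cardDistinctFactors_apply, ← List.card_toFinset] at h2
    rw [Nat.primeFactors, h2]
    push_cast
    have : (0 : ℝ) ≤ (k + 2) * ∑ p ∈ N.primesLE, if p ^ 2 ∣ n then (1 : ℝ) else 0 := by
      positivity
    linarith
  · rw [Nat.squarefree_iff_prime_squarefree] at hsq
    push Not at hsq
    obtain ⟨p, hp, hpn⟩ := hsq
    rw [← sq] at hpn
    have hpN : p ∈ N.primesLE := Nat.mem_primesLE.2 ⟨(Nat.le_of_dvd (Nat.pos_of_ne_zero hn.1)
      ((dvd_pow_self p two_ne_zero).trans hpn)).trans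
      (((Nat.le_floor_iff' hn.1).2 hn.2.1).trans hN), hp⟩
    have h2 : (1 : ℝ) ≤ ∑ p ∈ N.primesLE, if p ^ 2 ∣ n then (1 : ℝ) else 0 := by
      refine le_trans ?_ (Finset.single_le_sum (fun q _ => by positivity) hpN)
      rw [if_pos hpn]
    have h3 : (0 : ℝ) ≤ n.primeFactors.card := Nat.cast_nonneg _
    nlinarith

lemma apCount_le_succ_two_mul (k : ℕ) (y : ℝ) : apCount k y ≤ apCount (k + 1) (2 * y) := by
  have := card_filter_dvd_almostPrimesLE (k := k) (2 * y) two_ne_zero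
    (ArithmeticFunction.cardFactors_apply_prime Nat.prime_two)
  rw [Nat.cast_ofNat, mul_div_cancel_left₀ y two_ne_zero] at this
  rw [← this]
  exact Nat.cast_le.2 (Finset.card_filter_le _ _)

lemma apCount_eq_zero_of_lt_two_pow {k : ℕ} {y : ℝ} (hy : y < 2 ^ k) : apCount k y = 0 := by
  induction k generalizing y with
  | zero => exact apCount_eq_zero_of_lt_one (by simpa using hy)
  | succ k ih =>
    refine le_antisymm ((apCount_succ_le_sum k y le_rfl).trans
      (Finset.sum_nonpos fun p hp => (ih ?_).le)) (apCount_nonneg _ _)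
    have hp2 : (2 : ℝ) ≤ p := by exact_mod_cast (Nat.prime_of_mem_primesLE hp).two_le
    rw [div_lt_iff₀ (by linarith)]
    calc y < 2 ^ k * 2 := by rwa [← pow_succ]
      _ ≤ 2 ^ k * p := by gcongr

lemma apCount_pos {k : ℕ} {y : ℝ} (hy : 2 ^ k ≤ y) : 0 < apCount k y := by
  induction k generalizing y with
  | zero => rw [apCount_zero (by simpa using hy)]; exact one_pos
  | succ k ih =>
    have h := apCount_le_succ_two_mul k (y / 2)
    rw [mul_div_cancel₀ y two_ne_zero] at h
    refine (ih ?_).trans_le h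
    rw [le_div_iff₀ two_pos, ← pow_succ]
    exact hy

lemma eventually_apCount_pos (k : ℕ) : ∀ᶠ y in atTop, 0 < apCount k y :=
  (eventually_ge_atTop (2 ^ k)).mono fun _ => apCount_pos

/-- A Potter-type bound for monotone functions that are regularly varying of index one. -/
lemma exists_le_mul_rpow_mul_of_regular {f : ℝ → ℝ} (hf : Monotone f) (hf0 : ∀ y, 0 ≤ f y)
    {y₀ : ℝ} (hy₀ : 0 < y₀) (hlt : ∀ y < y₀, f y = 0) (hpos : 0 < f y₀)
    (hreg : (fun y => f (y / 2) - 2⁻¹ * f y) =o[atTop] f) {θ : ℝ} (hθ0 : 0 ≤ θ) (hθ : θ < 1) :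
    ∃ C, 0 < C ∧ ∀ y c, 1 ≤ c → f (y / c) ≤ C * c ^ (-θ) * f y := by
  have hθ2 : (2 : ℝ)⁻¹ < 2 ^ (-θ) := by
    rw [← rpow_neg_one]
    exact rpow_lt_rpow_of_exponent_lt one_lt_two (by linarith)
  obtain ⟨Y₁, hY₁⟩ := eventually_atTop.1 (hreg.bound (sub_pos.2 hθ2))
  set Y := max Y₁ y₀ with hY
  have hYpos : 0 < Y := hy₀.trans_le (le_max_right _ _)
  have hhalf : ∀ y, Y ≤ y → f (y / 2) ≤ 2 ^ (-θ) * f y := fun y hy => by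
    have := hY₁ y ((le_max_left _ _).trans hy)
    rw [norm_of_nonneg (hf0 y)] at this
    linarith [le_of_abs_le this]
  have hfY : f y₀ ≤ f Y := hf (le_max_right _ _)
  set C := max ((2 : ℝ) ^ θ) (f Y / f y₀ * (Y / y₀) ^ θ) with hC
  have hCpos : 0 < C := lt_of_lt_of_le (by positivity) (le_max_left _ _)
  refine ⟨C, hCpos, ?_⟩
  have key : ∀ n : ℕ, ∀ y, y ≤ 2 ^ n * Y → ∀ c, 1 ≤ c → f (y / c) ≤ C * c ^ (-θ) * f y := by
    intro n
    induction n with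
    | zero =>
      intro y hy c hc
      have hc0 : 0 < c := by linarith
      rw [pow_zero, one_mul] at hy
      rcases lt_or_ge (y / c) y₀ with h | h
      · rw [hlt _ h]
        have := hf0 y
        positivity
      have hyc : y₀ * c ≤ y := (le_div_iff₀ hc0).1 h
      have hcY : c ≤ Y / y₀ := by
        rw [le_div_iff₀ hy₀]
        linarith
      have hyy : y₀ ≤ y := by nlinarith
      have hyY : y / c ≤ Y := (div_le_self (hy₀.le.trans hyy) hc).trans hy
      calc f (y / c) ≤ f Y := hf hyY
        _ = f Y / f y₀ * (c ^ θ * c ^ (-θ)) * f y₀ := by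
          rw [← rpow_add hc0, add_neg_cancel, rpow_zero]
          field_simp
        _ ≤ f Y / f y₀ * ((Y / y₀) ^ θ * c ^ (-θ)) * f y := by
          have := hf hyy
          have := hf0 Y
          gcongr
        _ = (f Y / f y₀ * (Y / y₀) ^ θ) * c ^ (-θ) * f y := by ring
        _ ≤ C * c ^ (-θ) * f y := by
          have := hf0 y
          gcongr
          exact le_max_right _ _
    | succ n ih =>
      intro y hy c hc
      have hc0 : 0 < c := by linarith
      rcases le_or_gt y Y with h | h
      · exact ih y (h.trans (le_mul_of_one_le_left hYpos.le (one_le_pow₀ one_le_two))) c hc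
      have hfy := hf0 y
      have h2 : (2 : ℝ) ^ θ * 2 ^ (-θ) = 1 := by
        rw [← rpow_add two_pos, add_neg_cancel, rpow_zero]
      rcases le_or_gt 2 c with h' | h'
      · have h1 := ih (y / 2) (by rw [pow_succ] at hy; linarith) (c / 2) (by linarith)
        rw [div_div_div_cancel_right₀ two_ne_zero, div_rpow hc0.le zero_le_two] at h1
        calc f (y / c) ≤ C * (c ^ (-θ) / 2 ^ (-θ)) * f (y / 2) := h1
          _ ≤ C * (c ^ (-θ) / 2 ^ (-θ)) * (2 ^ (-θ) * f y) := by
            gcongr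
            exact hhalf y h.le
          _ = C * c ^ (-θ) * f y := by field_simp
      · calc f (y / c) ≤ 1 * f y := by
              rw [one_mul]
              exact hf (div_le_self (hYpos.trans h).le hc)
          _ ≤ C * c ^ (-θ) * f y := by
            gcongr
            rw [← h2]
            exact mul_le_mul (le_max_left _ _)
              (rpow_le_rpow_of_nonpos hc0 h'.le (by linarith)) (by positivity) hCpos.le
  intro y c hc
  obtain ⟨n, hn⟩ := pow_unbounded_of_one_lt (y / Y) one_lt_two
  exact key n y ((div_lt_iff₀ hYpos).1 hn).le c hc

/-- The counting function of `k`-almost primes is regularly varying of index one. -/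
def ApRegular (k : ℕ) : Prop :=
  ∀ c : ℝ, 1 ≤ c → (fun y => apCount k (y / c) - c⁻¹ * apCount k y) =o[atTop] apCount k

lemma ApRegular.exists_le_mul_rpow_mul {k : ℕ} (hk : ApRegular k) {θ : ℝ} (hθ0 : 0 ≤ θ)
    (hθ : θ < 1) : ∃ C, 0 < C ∧ ∀ y c, 1 ≤ c → apCount k (y / c) ≤ C * c ^ (-θ) * apCount k y :=
  exists_le_mul_rpow_mul_of_regular (apCount_mono k) (apCount_nonneg k) (pow_pos two_pos k)
    (fun _ => apCount_eq_zero_of_lt_two_pow) (apCount_pos le_rfl) (hk 2 one_le_two) hθ0 hθ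

lemma apCount_one_isEquivalent : apCount 1 ~[atTop] fun y => y / log y := by
  refine isEquivalent_of_tendsto_one
    (tendsto_primeCounting_mul_log_div_self.congr' ?_)
  filter_upwards [eventually_gt_atTop 1] with y hy
  have := log_pos hy
  rw [Pi.div_apply, apCount_one]
  field_simp

lemma apRegular_one : ApRegular 1 := by
  intro c hc
  have hc0 : 0 < c := by linarith
  have hdiv : Tendsto (fun y : ℝ => y / c) atTop atTop := tendsto_id.atTop_div_const hc0
  have h1 : (fun y : ℝ => y / c / log (y / c)) ~[atTop] fun y => c⁻¹ * (y / log y) := by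
    refine isEquivalent_of_tendsto_one ?_
    have h2 : Tendsto (fun y : ℝ => 1 + log c / log (y / c)) atTop (𝓝 (1 + 0)) :=
      tendsto_const_nhds.add (tendsto_const_nhds.div_atTop (tendsto_log_atTop.comp hdiv))
    rw [add_zero] at h2
    refine h2.congr' ?_
    filter_upwards [eventually_gt_atTop c] with y hy
    have hy0 : 0 < y := hc0.trans hy
    have h3 : 0 < log (y / c) := log_pos ((one_lt_div hc0).2 hy)
    have h4 : 0 < log y := log_pos (by linarith)
    have h5 : log y = log (y / c) + log c := by
      rw [log_div hy0.ne' hc0.ne']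
      ring
    rw [Pi.div_apply]
    field_simp
    linarith
  have h2 : (fun y => apCount 1 (y / c)) ~[atTop] fun y => c⁻¹ * apCount 1 y :=
    ((apCount_one_isEquivalent.comp_tendsto hdiv).trans h1).trans
      (IsEquivalent.refl.mul apCount_one_isEquivalent).symm
  exact h2.isLittleO.trans_isBigO (isBigO_const_mul_self _ _ _)

lemma apCount_zero_isLittleO : apCount 0 =o[atTop] apCount 1 := by
  have h1 : Tendsto (apCount 1) atTop atTop := by
    refine (tendsto_natCast_atTop_atTop.comp
      (Nat.tendsto_primeCounting.comp (tendsto_nat_floor_atTop (α := ℝ)))).congr fun y => ?_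
    rw [apCount_one]
    rfl
  refine IsLittleO.congr' (isLittleO_const_left.2 (Or.inr (tendsto_norm_atTop_atTop.comp h1)))
    ((eventually_ge_atTop 1).mono fun y hy => (apCount_zero hy).symm) EventuallyEq.rfl

lemma exists_le_sum_primesLE_inv (M : ℝ) : ∃ P : ℕ, M ≤ ∑ p ∈ P.primesLE, (p : ℝ)⁻¹ := by
  by_contra! h
  refine not_summable_one_div_on_primes
    (summable_of_sum_range_le (c := M) (fun n => ?_) fun n => ?_)
  · exact Set.indicator_nonneg (fun _ _ => by positivity) _
  · refine le_trans ?_ (h n).le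
    rw [Finset.sum_indicator_eq_sum_filter]
    simp only [one_div]
    refine Finset.sum_le_sum_of_subset_of_nonneg (fun p hp => ?_) fun _ _ _ => by positivity
    rw [Finset.mem_filter, Finset.mem_range] at hp
    exact Nat.mem_primesLE.2 ⟨hp.1.le, hp.2⟩

lemma ApRegular.isLittleO_succ {k : ℕ} (hk : ApRegular k) :
    apCount k =o[atTop] apCount (k + 1) := by
  rw [isLittleO_iff]
  intro ε hε
  obtain ⟨P, hP⟩ := exists_le_sum_primesLE_inv ((k + 1) / ε + 1)
  have h1 : (fun y => ∑ p ∈ P.primesLE, (apCount k (y / p) - (p : ℝ)⁻¹ * apCount k y)) =o[atTop]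
      apCount k := IsLittleO.fun_sum fun p hp => hk p (by
    exact_mod_cast (Nat.prime_of_mem_primesLE hp).one_le)
  filter_upwards [h1.bound one_pos, eventually_ge_atTop (P : ℝ)] with y hy hyP
  rw [norm_of_nonneg (apCount_nonneg k y), norm_of_nonneg (apCount_nonneg _ y)]
  rw [norm_of_nonneg (apCount_nonneg k y), one_mul, Finset.sum_sub_distrib, ← Finset.sum_mul]
    at hy
  have h2 := sum_apCount_le_succ k y le_rfl
  have h3 : ∑ p ∈ P.primesLE, apCount k (y / p) ≤ ∑ p ∈ ⌊y⌋₊.primesLE, apCount k (y / p) := by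
    refine Finset.sum_le_sum_of_subset_of_nonneg (fun p hp => ?_)
      fun _ _ _ => apCount_nonneg _ _
    rw [Nat.mem_primesLE] at hp ⊢
    exact ⟨hp.1.trans (Nat.le_floor hyP), hp.2⟩
  have h4 := neg_le_of_abs_le hy
  have h5 := mul_le_mul_of_nonneg_right hP (apCount_nonneg k y)
  have h6 : (k + 1) / ε * apCount k y ≤ (k + 1) * apCount (k + 1) y := by linarith
  have hk1 : (0 : ℝ) < k + 1 := by positivity
  rw [div_mul_eq_mul_div, div_le_iff₀ hε, mul_assoc] at h6
  linarith [le_of_mul_le_mul_left h6 hk1]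

lemma exists_sum_primesLE_rpow_le :
    ∃ D : ℝ, ∀ N : ℕ, ∑ p ∈ N.primesLE, ((p : ℝ) ^ 2 / 2) ^ (-(3 / 4) : ℝ) ≤ D := by
  have hs : Summable fun n : ℕ => ((n : ℝ) ^ 2 / 2) ^ (-(3 / 4) : ℝ) := by
    have := (summable_nat_rpow (p := -(3 / 2 : ℝ))).2 (by norm_num)
    refine (this.div_const ((2 : ℝ) ^ (-(3 / 4) : ℝ))).congr fun n => ?_
    rw [div_rpow (by positivity) zero_le_two, ← rpow_natCast, ← rpow_mul (Nat.cast_nonneg n)]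
    norm_num
  exact ⟨_, fun N => hs.sum_le_tsum _ fun n _ => by positivity⟩

lemma ApRegular.exists_succ_mul_apCount_sub_le {k : ℕ} (hk : ApRegular (k + 1)) :
    ∃ C, 0 ≤ C ∧ ∀ y, ∀ N : ℕ, ⌊y⌋₊ ≤ N → (k + 2) * apCount (k + 2) y -
      ∑ p ∈ N.primesLE, apCount (k + 1) (y / p) ≤ C * apCount (k + 1) y := by
  obtain ⟨C, hC, hpot⟩ := hk.exists_le_mul_rpow_mul (θ := 3 / 4) (by norm_num) (by norm_num)
  obtain ⟨D, hD⟩ := exists_sum_primesLE_rpow_le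
  have hD0 : 0 ≤ D := le_trans (Finset.sum_nonneg fun _ _ => by positivity) (hD 0)
  refine ⟨(k + 2) * (C * D), by positivity, fun y N hN => ?_⟩
  have h1 := succ_mul_apCount_le k y hN
  have h2 : ∑ p ∈ N.primesLE, apCount k (y / ((p ^ 2 : ℕ) : ℝ)) ≤ C * D * apCount (k + 1) y :=
    calc ∑ p ∈ N.primesLE, apCount k (y / ((p ^ 2 : ℕ) : ℝ))
        ≤ ∑ p ∈ N.primesLE, C * ((p : ℝ) ^ 2 / 2) ^ (-(3 / 4) : ℝ) * apCount (k + 1) y := by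
          refine Finset.sum_le_sum fun p hp => ?_
          have hp2 : (2 : ℝ) ≤ p := by exact_mod_cast (Nat.prime_of_mem_primesLE hp).two_le
          refine (apCount_le_succ_two_mul _ _).trans ?_
          have := hpot y ((p : ℝ) ^ 2 / 2) (by nlinarith)
          rwa [Nat.cast_pow, show 2 * (y / (p : ℝ) ^ 2) = y / ((p : ℝ) ^ 2 / 2) by field_simp]
      _ = C * (∑ p ∈ N.primesLE, ((p : ℝ) ^ 2 / 2) ^ (-(3 / 4) : ℝ)) * apCount (k + 1) y := by
          rw [Finset.mul_sum, Finset.sum_mul]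
      _ ≤ C * D * apCount (k + 1) y := by
          have := apCount_nonneg (k + 1) y
          gcongr
          exact hD N
  have h3 : (0 : ℝ) ≤ k + 2 := by positivity
  nlinarith

lemma ApRegular.exists_abs_sum_sub_le {k : ℕ} (hk : ApRegular k) {c : ℝ} (hc : 1 ≤ c) {ε : ℝ}
    (hε : 0 < ε) : ∃ B, 0 ≤ B ∧ ∀ y, |∑ p ∈ ⌊y⌋₊.primesLE, apCount k (y / c / p) -
      c⁻¹ * ∑ p ∈ ⌊y⌋₊.primesLE, apCount k (y / p)| ≤
        ε * ∑ p ∈ ⌊y⌋₊.primesLE, apCount k (y / p) + B * apCount 1 y := by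
  obtain ⟨M, hM⟩ := eventually_atTop.1 ((hk c hc).bound hε)
  refine ⟨apCount k M, apCount_nonneg _ _, fun y => ?_⟩
  have hterm : ∀ z, 0 ≤ z →
      |apCount k (z / c) - c⁻¹ * apCount k z| ≤ ε * apCount k z + apCount k M := by
    intro z hz0
    have h0 := apCount_nonneg k z
    have h1 := apCount_nonneg k M
    rcases le_or_gt M z with hz | hz
    · have := hM z hz
      rw [norm_of_nonneg h0, norm_eq_abs] at this
      linarith
    · have h2 : apCount k z ≤ apCount k M := apCount_mono k hz.le
      have h3 : apCount k (z / c) ≤ apCount k z := apCount_mono k (div_le_self hz0 hc)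
      have h4 := apCount_nonneg k (z / c)
      have h5 : c⁻¹ * apCount k z ≤ apCount k z :=
        mul_le_of_le_one_left h0 (inv_le_one_of_one_le₀ hc)
      have h6 : 0 ≤ c⁻¹ * apCount k z := mul_nonneg (inv_nonneg.2 (by linarith)) h0
      have h7 := mul_nonneg hε.le h0
      rw [abs_le]
      constructor <;> linarith
  rcases lt_or_ge y 1 with hy | hy
  · have : ⌊y⌋₊.primesLE = ∅ := by
      rw [Nat.floor_eq_zero.2 hy]
      rfl
    rw [this]
    simpa using mul_nonneg (apCount_nonneg k M) (apCount_nonneg 1 y)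
  rw [Finset.mul_sum, ← Finset.sum_sub_distrib]
  refine (Finset.abs_sum_le_sum_abs _ _).trans ?_
  rw [apCount_one, ← Nat.primesLE_card_eq_primeCounting, Finset.cast_card, Finset.mul_sum,
    Finset.mul_sum, ← Finset.sum_add_distrib]
  refine Finset.sum_le_sum fun p _ => ?_
  rw [div_right_comm, mul_one]
  exact hterm (y / p) (by positivity)

lemma ApRegular.succ {k : ℕ} (hk : ApRegular (k + 1))
    (hone : apCount 1 =o[atTop] apCount (k + 2)) : ApRegular (k + 2) := by
  intro c hc
  have hc0 : 0 < c := by linarith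
  have hK : (0 : ℝ) < k + 2 := by positivity
  obtain ⟨C, hC0, hC⟩ := hk.exists_succ_mul_apCount_sub_le
  rw [isLittleO_iff]
  intro ε hε
  obtain ⟨B, hB0, hB⟩ := hk.exists_abs_sum_sub_le hc (half_pos hε)
  have hsmall : (fun y => 2 * C * apCount (k + 1) y + B * apCount 1 y) =o[atTop]
      apCount (k + 2) :=
    (hk.isLittleO_succ.const_mul_left _).add (hone.const_mul_left _)
  filter_upwards [hsmall.bound (show 0 < (k + 2) * (ε / 2) by positivity),
    eventually_ge_atTop 1] with y hy hy1
  have hg := apCount_nonneg (k + 2) y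
  rw [norm_of_nonneg hg] at hy ⊢
  have hfl : ⌊y / c⌋₊ ≤ ⌊y⌋₊ := Nat.floor_le_floor (div_le_self (by linarith) hc)
  have h1 := hC y _ le_rfl
  have h2 := sum_apCount_le_succ (k + 1) y le_rfl
  have h3 := hC (y / c) _ hfl
  have h4 := sum_apCount_le_succ (k + 1) (y / c) hfl
  have h5 := abs_le.1 (hB y)
  have h6 : apCount (k + 1) (y / c) ≤ apCount (k + 1) y :=
    apCount_mono _ (div_le_self (by linarith) hc)
  have h7 := le_of_abs_le hy
  push_cast at h2 h4
  rw [show (k : ℝ) + 1 + 1 = k + 2 by ring, show k + 1 + 1 = k + 2 from rfl] at h2 h4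
  set T := ∑ p ∈ ⌊y⌋₊.primesLE, apCount (k + 1) (y / p)
  set U := ∑ p ∈ ⌊y⌋₊.primesLE, apCount (k + 1) (y / c / p)
  have hci : 0 < c⁻¹ := inv_pos.2 hc0
  have hci1 : c⁻¹ ≤ 1 := inv_le_one_of_one_le₀ hc
  have h8 : C * apCount (k + 1) (y / c) ≤ C * apCount (k + 1) y := by gcongr
  have h9 : 0 ≤ C * apCount (k + 1) y := mul_nonneg hC0 (apCount_nonneg _ _)
  have h10 : ε / 2 * T ≤ ε / 2 * ((k + 2) * apCount (k + 2) y) := by gcongr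
  have h11 : c⁻¹ * ((k + 2) * apCount (k + 2) y - T) ≤ C * apCount (k + 1) y :=
    (mul_le_of_le_one_left (by linarith) hci1).trans h1
  have h12 : 0 ≤ c⁻¹ * ((k + 2) * apCount (k + 2) y - T) := mul_nonneg hci.le (by linarith)
  have h13 : |(k + 2) * (apCount (k + 2) (y / c) - c⁻¹ * apCount (k + 2) y)| ≤
      (k + 2) * (ε * apCount (k + 2) y) := by
    rw [abs_le]
    constructor <;> linarith
  rw [abs_mul, abs_of_pos hK] at h13
  exact le_of_mul_le_mul_left h13 hK

theorem apRegular_succ (k : ℕ) :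
    ApRegular (k + 1) ∧ apCount 1 =o[atTop] apCount (k + 2) := by
  induction k with
  | zero => exact ⟨apRegular_one, apRegular_one.isLittleO_succ⟩
  | succ k ih =>
    have h := ih.1.succ ih.2
    exact ⟨h, ih.2.trans h.isLittleO_succ⟩

lemma mem_Psigma_const_one_iff {k n : ℕ} :
    n ∈ Psigma (fun _ : Fin k => 1) ↔ n ≠ 0 ∧ Ω n = k := by
  constructor
  · rintro ⟨p, hp, rfl⟩
    simp only [pow_one]
    refine ⟨Finset.prod_ne_zero_iff.2 fun i _ => (hp i).ne_zero, ?_⟩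
    induction k with
    | zero => simp
    | succ k ih =>
      rw [Fin.prod_univ_succ, ArithmeticFunction.cardFactors_mul (hp 0).ne_zero
        (Finset.prod_ne_zero_iff.2 fun i _ => (hp _).ne_zero),
        ArithmeticFunction.cardFactors_apply_prime (hp 0), ih _ fun i => hp _, add_comm]
  · rintro ⟨h0, rfl⟩
    refine ⟨n.primeFactorsList.get,
      fun i => Nat.prime_of_mem_primeFactorsList (List.get_mem _ i), ?_⟩
    simp only [pow_one]
    conv_lhs => rw [← Nat.prod_primeFactorsList h0]
    conv_lhs => rw [← List.ofFn_get n.primeFactorsList]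
    exact List.prod_ofFn

lemma countIn_Psigma_const_one (k : ℕ) (y : ℝ) :
    (countIn (Psigma (fun _ : Fin k => 1)) y : ℝ) = apCount k y := by
  have : {n : ℕ | (n : ℝ) ≤ y ∧ n ∈ Psigma (fun _ : Fin k => 1)} = almostPrimesLE k y := by
    ext n
    rw [Set.mem_ofPred_eq, mem_Psigma_const_one_iff, Finset.mem_coe, mem_almostPrimesLE]
    tauto
  rw [countIn, this, apCount, Nat.card_coe_set_eq, Set.ncard_coe_finset]

lemma mem_Psigma_append_iff {k r α n : ℕ} {β : Fin r → ℕ} :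
    n ∈ Psigma (Fin.append (fun _ : Fin k => α) β) ↔
      ∃ m, (m ≠ 0 ∧ Ω m = k) ∧ ∃ b ∈ Psigma β, n = m ^ α * b := by
  simp only [← mem_Psigma_const_one_iff]
  constructor
  · rintro ⟨p, hp, rfl⟩
    refine ⟨_, ⟨fun i => p (Fin.castAdd r i), fun i => hp _, rfl⟩, _,
      ⟨fun i => p (Fin.natAdd k i), fun i => hp _, rfl⟩, ?_⟩
    simp only [Fin.prod_univ_add, Fin.append_left, Fin.append_right, pow_one, Finset.prod_pow]
  · rintro ⟨_, ⟨p, hp, rfl⟩, _, ⟨q, hq, rfl⟩, rfl⟩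
    refine ⟨Fin.append p q, fun i => ?_, ?_⟩
    · refine Fin.addCases (fun i => ?_) (fun i => ?_) i
      · simpa using hp i
      · simpa using hq i
    · simp only [Fin.prod_univ_add, Fin.append_left, Fin.append_right, pow_one, Finset.prod_pow]

lemma Psigma.pos {r : ℕ} {β : Fin r → ℕ} {b : ℕ} (hb : b ∈ Psigma β) : 0 < b := by
  obtain ⟨p, hp, rfl⟩ := hb
  exact Finset.prod_pos fun i _ => pow_pos (hp i).pos _

lemma Psigma.one_le_rpow_one_div {r : ℕ} {β : Fin r → ℕ} (α : ℕ) (b : Psigma β) :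
    (1 : ℝ) ≤ ((b : ℕ) : ℝ) ^ ((1 : ℝ) / α) :=
  one_le_rpow (by exact_mod_cast Psigma.pos b.2) (by positivity)

lemma Psigma.nonempty {r : ℕ} (β : Fin r → ℕ) : (Psigma β).Nonempty :=
  ⟨_, fun _ => 2, fun _ => Nat.prime_two, rfl⟩

lemma summable_prod_rpow {r : ℕ} {s : Fin r → ℝ} (hs : ∀ i, s i < -1) :
    Summable fun p : Fin r → ℕ => ∏ i, (p i : ℝ) ^ s i := by
  induction r with
  | zero => exact Summable.of_finite
  | succ r ih =>
    rw [← (Fin.consEquiv fun _ : Fin (r + 1) => ℕ).summable_iff]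
    refine (Summable.mul_of_nonneg (summable_nat_rpow.2 (hs 0)) (ih fun i => hs i.succ)
      (fun n => by positivity) fun p => ?_).congr fun x => ?_
    · exact Finset.prod_nonneg fun i _ => by positivity
    · rw [Function.comp_apply, Fin.prod_univ_succ]
      simp [Fin.consEquiv]

lemma summable_Psigma_rpow {r : ℕ} {β : Fin r → ℕ} {s : ℝ} (hs : ∀ i, β i * s < -1) :
    Summable fun b : Psigma β => ((b : ℕ) : ℝ) ^ s := by
  choose p hp hpb using fun b : Psigma β => b.2
  have hinj : Function.Injective p := fun a b hab => Subtype.ext (by rw [hpb a, hpb b, hab])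
  refine ((summable_prod_rpow hs).comp_injective hinj).congr fun b => ?_
  rw [Function.comp_apply, hpb b, Nat.cast_prod,
    ← Real.finsetProd_rpow _ _ fun i _ => Nat.cast_nonneg _]
  refine Finset.prod_congr rfl fun i _ => ?_
  rw [Nat.cast_pow, rpow_mul (Nat.cast_nonneg _), rpow_natCast]

lemma natCast_pow_mul_le_iff {α m b : ℕ} (hα : 0 < α) (hb : 0 < b) {x : ℝ} (hx : 0 ≤ x) :
    ((m ^ α * b : ℕ) : ℝ) ≤ x ↔
      (m : ℝ) ≤ x ^ ((1 : ℝ) / α) / (b : ℝ) ^ ((1 : ℝ) / α) := by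
  have hb' : (0 : ℝ) < b := by exact_mod_cast hb
  have hα' : (0 : ℝ) < α := by exact_mod_cast hα
  rw [← div_rpow hx hb'.le, one_div, Real.le_rpow_inv_iff_of_pos (by positivity)
    (by positivity) hα', rpow_natCast, le_div_iff₀ hb', Nat.cast_mul, Nat.cast_pow]

lemma finite_setOf_natCast_le_and_mem (S : Set ℕ) (x : ℝ) :
    {n : ℕ | (n : ℝ) ≤ x ∧ n ∈ S}.Finite :=
  (Set.finite_Iic ⌊x⌋₊).subset fun _ hn => Nat.le_floor hn.1

lemma countIn_append_le_tsum {k r α : ℕ} (hα : 0 < α) {β : Fin r → ℕ} {x : ℝ} (hx : 0 ≤ x)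
    (hs : Summable fun b : Psigma β =>
      apCount k (x ^ ((1 : ℝ) / α) / ((b : ℕ) : ℝ) ^ ((1 : ℝ) / α))) :
    (countIn (Psigma (Fin.append (fun _ : Fin k => α) β)) x : ℝ) ≤
      ∑' b : Psigma β, apCount k (x ^ ((1 : ℝ) / α) / ((b : ℕ) : ℝ) ^ ((1 : ℝ) / α)) := by
  classical
  have hfin : {b : Psigma β | ((b : ℕ) : ℝ) ≤ x}.Finite :=
    ((finite_setOf_natCast_le_and_mem (Psigma β) x).preimage
      Subtype.val_injective.injOn).subset fun b hb => ⟨hb, b.2⟩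
  refine le_trans ?_ (hs.sum_le_tsum hfin.toFinset fun b _ => apCount_nonneg _ _)
  have hsub : {n : ℕ | (n : ℝ) ≤ x ∧ n ∈ Psigma (Fin.append (fun _ : Fin k => α) β)} ⊆
      (hfin.toFinset.biUnion fun b => (almostPrimesLE k
        (x ^ ((1 : ℝ) / α) / ((b : ℕ) : ℝ) ^ ((1 : ℝ) / α))).image fun m => m ^ α * b :
        Finset ℕ) := by
    rintro n ⟨hnx, hn⟩
    obtain ⟨m, ⟨hm0, hm⟩, b, hb, rfl⟩ := mem_Psigma_append_iff.1 hn
    rw [Finset.mem_coe, Finset.mem_biUnion]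
    refine ⟨⟨b, hb⟩, ?_, Finset.mem_image.2 ⟨m, mem_almostPrimesLE.2 ⟨hm0,
      (natCast_pow_mul_le_iff hα (Psigma.pos hb) hx).1 hnx, hm⟩, rfl⟩⟩
    rw [Set.Finite.mem_toFinset]
    refine le_trans ?_ hnx
    exact_mod_cast Nat.le_mul_of_pos_left b (pow_pos (Nat.pos_of_ne_zero hm0) α)
  rw [countIn, Nat.card_coe_set_eq]
  refine (Nat.cast_le.2 ((Set.ncard_le_ncard hsub (Finset.finite_toSet _)).trans
    (Set.ncard_coe_finset _).le)).trans ?_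
  refine (Nat.cast_le.2 Finset.card_biUnion_le).trans ?_
  rw [Nat.cast_sum]
  exact Finset.sum_le_sum fun b _ => Nat.cast_le.2 Finset.card_image_le

lemma apCount_sub_le_card_filter (k P : ℕ) (z : ℝ) :
    apCount (k + 1) z - ∑ p ∈ P.primesLE, apCount k (z / p) ≤
      ({m ∈ almostPrimesLE (k + 1) z | ∀ p ∈ P.primesLE, ¬ p ∣ m}.card : ℝ) := by
  have h1 : ∑ p ∈ P.primesLE, apCount k (z / p) =
      ∑ p ∈ P.primesLE, (({m ∈ almostPrimesLE (k + 1) z | p ∣ m}.card : ℕ) : ℝ) :=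
    Finset.sum_congr rfl fun p hp => by
      have hp' := Nat.prime_of_mem_primesLE hp
      rw [card_filter_dvd_almostPrimesLE z hp'.ne_zero
        (ArithmeticFunction.cardFactors_apply_prime hp')]
  rw [h1, sub_le_iff_le_add', apCount]
  norm_cast
  rw [← Finset.card_filter_add_card_filter_not (s := almostPrimesLE (k + 1) z)
    (fun m => ∃ p ∈ P.primesLE, p ∣ m)]
  refine Nat.add_le_add ?_ ?_
  · refine le_trans (Finset.card_le_card fun m hm => ?_) Finset.card_biUnion_le
    rw [Finset.mem_filter] at hm
    obtain ⟨hm, p, hp, hpm⟩ := hm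
    exact Finset.mem_biUnion.2 ⟨p, hp, Finset.mem_filter.2 ⟨hm, hpm⟩⟩
  · push Not
    rfl

lemma coprime_of_forall_primesLE_not_dvd {P b m : ℕ} (hb0 : 0 < b) (hb : b ≤ P)
    (hm : ∀ p ∈ P.primesLE, ¬ p ∣ m) : Nat.Coprime b m :=
  Nat.coprime_of_dvd fun p hp hpb =>
    hm p (Nat.mem_primesLE.2 ⟨(Nat.le_of_dvd hb0 hpb).trans hb, hp⟩)

lemma sum_sub_le_countIn_append {k r α : ℕ} (hα : 0 < α) {β : Fin r → ℕ} {x : ℝ} (hx : 0 ≤ x)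
    (F : Finset (Psigma β)) {P : ℕ} (hP : ∀ b ∈ F, (b : ℕ) ≤ P) :
    ∑ b ∈ F, apCount (k + 1) (x ^ ((1 : ℝ) / α) / ((b : ℕ) : ℝ) ^ ((1 : ℝ) / α)) -
        F.card * P.primesLE.card * apCount k (x ^ ((1 : ℝ) / α)) ≤
      (countIn (Psigma (Fin.append (fun _ : Fin (k + 1) => α) β)) x : ℝ) := by
  classical
  set y := x ^ ((1 : ℝ) / α) with hy
  have hy0 : 0 ≤ y := by positivity
  set R : Psigma β → Finset ℕ := fun b =>
    {m ∈ almostPrimesLE (k + 1) (y / ((b : ℕ) : ℝ) ^ ((1 : ℝ) / α)) | ∀ p ∈ P.primesLE, ¬ p ∣ m}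
    with hR
  have h1 : ((F.sigma R).card : ℝ) ≤
      (countIn (Psigma (Fin.append (fun _ : Fin (k + 1) => α) β)) x : ℝ) := by
    rw [countIn, Nat.card_coe_set_eq, Nat.cast_le, ← Set.ncard_coe_finset]
    refine Set.ncard_le_ncard_of_injOn (fun v => v.2 ^ α * (v.1 : ℕ)) ?_ ?_
      (finite_setOf_natCast_le_and_mem _ _)
    · rintro ⟨b, m⟩ hv
      rw [Finset.mem_coe, Finset.mem_sigma, hR, Finset.mem_filter, mem_almostPrimesLE] at hv
      obtain ⟨-, ⟨hm0, hmy, hm⟩, -⟩ := hv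
      exact ⟨(natCast_pow_mul_le_iff hα (Psigma.pos b.2) hx).2 hmy,
        mem_Psigma_append_iff.2 ⟨m, ⟨hm0, hm⟩, b, b.2, rfl⟩⟩
    · rintro ⟨b, m⟩ hv ⟨b', m'⟩ hv' (heq : m ^ α * (b : ℕ) = m' ^ α * (b' : ℕ))
      rw [Finset.mem_coe, Finset.mem_sigma, hR, Finset.mem_filter] at hv hv'
      have hdvd : (b : ℕ) ∣ b' := by
        refine Nat.Coprime.dvd_of_dvd_mul_left (Nat.Coprime.pow_right α
          (coprime_of_forall_primesLE_not_dvd (Psigma.pos b.2) (hP b hv.1) hv'.2.2)) ?_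
        rw [← heq]
        exact dvd_mul_left _ _
      have hdvd' : (b' : ℕ) ∣ b := by
        refine Nat.Coprime.dvd_of_dvd_mul_left (Nat.Coprime.pow_right α
          (coprime_of_forall_primesLE_not_dvd (Psigma.pos b'.2) (hP b' hv'.1) hv.2.2)) ?_
        rw [heq]
        exact dvd_mul_left _ _
      obtain rfl : b = b' := Subtype.ext (Nat.dvd_antisymm hdvd hdvd')
      obtain rfl : m = m' := Nat.pow_left_injective hα.ne'
        (Nat.eq_of_mul_eq_mul_right (Psigma.pos b.2) heq)
      rfl
  refine le_trans ?_ h1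
  rw [Finset.card_sigma, Nat.cast_sum, mul_assoc, ← nsmul_eq_mul, ← Finset.sum_const,
    ← Finset.sum_sub_distrib]
  refine Finset.sum_le_sum fun b _ => ?_
  refine le_trans (sub_le_sub_left ?_ _) (apCount_sub_le_card_filter k P _)
  rw [← nsmul_eq_mul]
  refine Finset.sum_le_card_nsmul _ _ _ fun p hp => apCount_mono k ?_
  have hb1 := Psigma.one_le_rpow_one_div α b
  have hp1 : (1 : ℝ) ≤ p := by exact_mod_cast (Nat.prime_of_mem_primesLE hp).one_le
  exact (div_le_self (by positivity) hp1).trans (div_le_self hy0 hb1)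

lemma tendsto_apCount_div_div {k r α : ℕ} {β : Fin r → ℕ} (hreg : ApRegular k)
    (b : Psigma β) :
    Tendsto (fun y => apCount k (y / ((b : ℕ) : ℝ) ^ ((1 : ℝ) / α)) / apCount k y) atTop
      (𝓝 (((b : ℕ) : ℝ) ^ (-(1 : ℝ) / α))) := by
  have h1 := (hreg _ (Psigma.one_le_rpow_one_div α b)).tendsto_div_nhds_zero
  have h2 := h1.add_const ((((b : ℕ) : ℝ) ^ ((1 : ℝ) / α))⁻¹)
  rw [zero_add] at h2
  rw [neg_div, rpow_neg (Nat.cast_nonneg _)]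
  refine h2.congr' ?_
  filter_upwards [eventually_apCount_pos k] with y hy
  rw [sub_div, mul_div_cancel_right₀ _ hy.ne', sub_add_cancel]

lemma tendsto_tsum_apCount_div {k r α : ℕ} (hα : 0 < α) {β : Fin r → ℕ} (h : ∀ i, α < β i) :
    (∀ y, Summable fun b : Psigma β => apCount (k + 1) (y / ((b : ℕ) : ℝ) ^ ((1 : ℝ) / α))) ∧
    Tendsto (fun y => (∑' b : Psigma β, apCount (k + 1) (y / ((b : ℕ) : ℝ) ^ ((1 : ℝ) / α))) /
      apCount (k + 1) y) atTop (𝓝 (∑' b : Psigma β, ((b : ℕ) : ℝ) ^ (-(1 : ℝ) / α))) := by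
  have hα' : (0 : ℝ) < α := by exact_mod_cast hα
  have hreg := (apRegular_succ k).1
  set θ : ℝ := (α + 1 / 2) / (α + 1) with hθ
  have hθ1 : θ < 1 := by
    rw [hθ, div_lt_one (by positivity)]
    linarith
  obtain ⟨C, hC, hpot⟩ := hreg.exists_le_mul_rpow_mul (θ := θ) (by positivity) hθ1
  have hc1 := fun b : Psigma β => Psigma.one_le_rpow_one_div α b
  have hsum : Summable fun b : Psigma β => C * (((b : ℕ) : ℝ) ^ ((1 : ℝ) / α)) ^ (-θ) := by
    refine Summable.mul_left C ((summable_Psigma_rpow (s := 1 / α * -θ) fun i => ?_).congr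
      fun b => rpow_mul (Nat.cast_nonneg _) _ _)
    have hi : (α : ℝ) + 1 ≤ β i := by exact_mod_cast h i
    have h1 : (α : ℝ) < β i * θ :=
      calc (α : ℝ) < (α + 1) * θ := by
            rw [hθ, mul_div_cancel₀ _ (by positivity)]
            linarith
        _ ≤ β i * θ := by gcongr
    have h2 : 1 < β i * θ / α := (one_lt_div hα').2 h1
    calc (β i : ℝ) * (1 / α * -θ) = -(β i * θ / α) := by ring
      _ < -1 := neg_lt_neg h2
  refine ⟨fun y => (hsum.mul_right (apCount (k + 1) y)).of_nonneg_of_le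
    (fun b => apCount_nonneg _ _) fun b => hpot y _ (hc1 b), ?_⟩
  simp_rw [← tsum_div_const]
  refine tendsto_tsum_of_dominated_convergence hsum (tendsto_apCount_div_div hreg) ?_
  · filter_upwards [eventually_apCount_pos (k + 1)] with y hy b
    rw [norm_of_nonneg (div_nonneg (apCount_nonneg _ _) hy.le), div_le_iff₀ hy]
    exact hpot y _ (hc1 b)

lemma apCount_isLittleO_succ : ∀ k : ℕ, apCount k =o[atTop] apCount (k + 1)
  | 0 => apCount_zero_isLittleO
  | k + 1 => (apRegular_succ k).1.isLittleO_succ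

lemma summable_Psigma_rpow_neg_one_div {r α : ℕ} (hα : 0 < α) {β : Fin r → ℕ}
    (h : ∀ i, α < β i) : Summable fun b : Psigma β => ((b : ℕ) : ℝ) ^ (-(1 : ℝ) / α) := by
  have hα' : (0 : ℝ) < α := by exact_mod_cast hα
  refine summable_Psigma_rpow fun i => ?_
  have h1 : (1 : ℝ) < β i / α := (one_lt_div hα').2 (by exact_mod_cast h i)
  calc (β i : ℝ) * (-1 / α) = -(β i / α) := by ring
    _ < -1 := neg_lt_neg h1

theorem tendsto_countIn_append_div {k r α : ℕ} (hα : 0 < α) {β : Fin r → ℕ}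
    (h : ∀ i, α < β i) :
    Tendsto (fun x : ℝ => (countIn (Psigma (Fin.append (fun _ : Fin (k + 1) => α) β)) x : ℝ) /
      apCount (k + 1) (x ^ ((1 : ℝ) / α))) atTop
      (𝓝 (∑' b : Psigma β, ((b : ℕ) : ℝ) ^ (-(1 : ℝ) / α))) := by
  have hα' : (0 : ℝ) < α := by exact_mod_cast hα
  have hroot : Tendsto (fun x : ℝ => x ^ ((1 : ℝ) / α)) atTop atTop :=
    tendsto_rpow_atTop (by positivity)
  have hpos := hroot.eventually (eventually_apCount_pos (k + 1))
  obtain ⟨hsum, hlim⟩ := tendsto_tsum_apCount_div (k := k) hα h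
  refine tendsto_order.2 ⟨fun a ha => ?_, fun a ha => ?_⟩
  · obtain ⟨F, hF⟩ := ((summable_Psigma_rpow_neg_one_div hα h).hasSum.eventually
      (lt_mem_nhds ha)).exists
    have hreg := (apRegular_succ k).1
    set P := F.sup fun b => (b : ℕ) with hP
    have h1 : Tendsto (fun y => ∑ b ∈ F,
        apCount (k + 1) (y / ((b : ℕ) : ℝ) ^ ((1 : ℝ) / α)) / apCount (k + 1) y -
        F.card * P.primesLE.card * (apCount k y / apCount (k + 1) y)) atTop
        (𝓝 (∑ b ∈ F, ((b : ℕ) : ℝ) ^ (-(1 : ℝ) / α) - F.card * P.primesLE.card * 0)) :=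
      (tendsto_finsetSum _ fun b _ => tendsto_apCount_div_div hreg b).sub
        ((apCount_isLittleO_succ k).tendsto_div_nhds_zero.const_mul _)
    rw [mul_zero, sub_zero] at h1
    filter_upwards [hroot.eventually (h1.eventually (lt_mem_nhds hF)), hpos,
      eventually_ge_atTop 0] with x hx hxpos hx0
    refine hx.trans_le ?_
    rw [← Finset.sum_div, ← mul_div_assoc, ← sub_div]
    gcongr
    exact sum_sub_le_countIn_append hα hx0 F fun b hb =>
      Finset.le_sup (f := fun b : Psigma β => (b : ℕ)) hb
  · filter_upwards [hroot.eventually (hlim.eventually (gt_mem_nhds ha)), hpos,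
      eventually_ge_atTop 0] with x hx hxpos hx0
    refine lt_of_le_of_lt ?_ hx
    gcongr
    exact countIn_append_le_tsum hα hx0 (hsum _)

end

/-- `σ_α(x) ∼ σ_k(x^{1/α}) ∑_{n ∈ 𝒫_β^σ} n^{-1/α}` where the exponent
vector is `(α,…,α,α₁,…,α_r)` with `k ≥ 1` copies of `α` and `α < αᵢ` for all `i`. -/
theorem main_theorem_sigma (k r α : ℕ) (hk : 1 ≤ k) (hα : 0 < α) (β : Fin r → ℕ)
    (h : ∀ i, α < β i) :
    Tendsto
      (fun x : ℝ =>
        (countIn (Psigma (Fin.append (fun _ : Fin k => α) β)) x : ℝ) /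
          ((countIn (Psigma (fun _ : Fin k => 1)) (x ^ ((1 : ℝ) / (α : ℝ))) : ℝ) *
            ∑' n : Psigma β, ((n : ℕ) : ℝ) ^ (-(1 : ℝ) / (α : ℝ))))
      atTop (nhds 1) := by
  obtain ⟨k, rfl⟩ := Nat.exists_eq_add_of_le' hk
  have hpos : 0 < ∑' n : Psigma β, ((n : ℕ) : ℝ) ^ (-(1 : ℝ) / (α : ℝ)) := by
    obtain ⟨b, hb⟩ := Psigma.nonempty β
    refine (summable_Psigma_rpow_neg_one_div hα h).tsum_pos (fun n => by positivity) ⟨b, hb⟩ ?_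
    exact rpow_pos_of_pos (by exact_mod_cast Psigma.pos hb) _
  have hlim := (tendsto_countIn_append_div (k := k) hα h).div_const
    (∑' n : Psigma β, ((n : ℕ) : ℝ) ^ (-(1 : ℝ) / (α : ℝ)))
  rw [div_self hpos.ne'] at hlim
  refine hlim.congr fun x => ?_
  rw [countIn_Psigma_const_one, div_div]
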